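/- Let $m > 2$ be an integer, $\Omega = \{|x|>1\}$, and let $Q_0$ be the radial ground state solution of $-\Delta Q = |Q|^{2m}Q$, $Q|_{|x|=1}=0$ (the minimizer of the Sobolev quotient). Then for all radial $f \in \dot H^1_0(\Omega)$: $\|f\|_{L^{2(m+1)}(\Omega)} \|\nabla Q_0\|_{L^2(\Omega)} \leq \|Q_0\|_{L^{2(m+1)}(\Omega)} \|\nabla f\|_{L^2(\Omega)}$, with equality if and only if $f = \sigma Q_0$ for some $\sigma \in \mathbb{R}$. -/

import Mathlib

open MeasureTheory Real Set Filter

/-- Radial profiles of functions in `Ḣ¹₀(Ω)`, `Ω = {|x| > 1} ⊂ ℝ³`,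
with finite `L^{2(m+1)}` norm. -/
def RadialH10 (m : ℕ) (f : ℝ → ℝ) : Prop :=
  ContinuousOn f (Ici 1) ∧ f 1 = 0 ∧ DifferentiableOn ℝ f (Ioi 1) ∧
  Tendsto f atTop (nhds 0) ∧
  IntegrableOn (fun r => (deriv f r)^2 * r^2) (Ioi 1) ∧
  IntegrableOn (fun r => |f r| ^ (2 * (m + 1)) * r^2) (Ioi 1)

/-- `‖∇f‖_{L²(Ω)}` in radial coordinates. -/
noncomputable def gradNorm (f : ℝ → ℝ) : ℝ :=
  Real.sqrt (4 * π * ∫ r in Ioi 1, (deriv f r)^2 * r^2)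

/-- `‖f‖_{L^{2(m+1)}(Ω)}` in radial coordinates. -/
noncomputable def lpNorm (m : ℕ) (f : ℝ → ℝ) : ℝ :=
  (4 * π * ∫ r in Ioi 1, |f r| ^ (2 * (m + 1)) * r^2)
    ^ ((1:ℝ) / (2 * ((m : ℝ) + 1)))

/-! ### Tail integrals -/

/-- The tail integral `r ↦ ∫_r^∞ g`. -/
noncomputable def tailIntegral (g : ℝ → ℝ) (r : ℝ) : ℝ := ∫ ρ in Ioi r, g ρ

section Tail

variable {g : ℝ → ℝ}

lemma tailIntegral_sub (hg : IntegrableOn g (Ioi 1)) {a b : ℝ} (ha : 1 ≤ a) (hb : 1 ≤ b) :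
    tailIntegral g a - tailIntegral g b = ∫ ρ in a..b, g ρ :=
  intervalIntegral.integral_Ioi_sub_Ioi' (hg.mono_set (Ioi_subset_Ioi ha))
    (hg.mono_set (Ioi_subset_Ioi hb))

lemma integrable_segment (hg : IntegrableOn g (Ioi 1)) {a b : ℝ} (ha : 1 ≤ a) (hb : 1 ≤ b) :
    IntervalIntegrable g volume a b :=
  intervalIntegrable_iff.2 (hg.mono_set fun _ hx => lt_of_le_of_lt (le_min ha hb) hx.1)

lemma integrableOn_segment (hg : IntegrableOn g (Ioi 1)) {a b : ℝ} (ha : 1 ≤ a) :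
    IntegrableOn g (Icc a b) :=
  (integrableOn_Icc_iff_integrableOn_Ioc).2 (hg.mono_set fun _ hx => lt_of_le_of_lt ha hx.1)

lemma tailIntegral_eq (hg : IntegrableOn g (Ioi 1)) {r : ℝ} (hr : 1 ≤ r) :
    tailIntegral g r = tailIntegral g 1 - ∫ ρ in (1 : ℝ)..r, g ρ := by
  linarith [tailIntegral_sub hg le_rfl hr]

lemma continuousOn_tailIntegral (hg : IntegrableOn g (Ioi 1)) :
    ContinuousOn (tailIntegral g) (Ici 1) := by
  have hloc : ∀ b : ℝ, 1 ≤ b → ContinuousOn (tailIntegral g) (Icc 1 b) := fun b hb =>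
    (continuousOn_const.sub (intervalIntegral.continuousOn_primitive_interval'
      (integrable_segment hg le_rfl hb) left_mem_uIcc)).congr (fun x hx => by
        simpa using tailIntegral_eq hg (by rw [uIcc_of_le hb] at hx; exact hx.1)) |>.mono
      (by rw [uIcc_of_le hb])
  intro x hx
  have hx1 : (1 : ℝ) ≤ x := hx
  refine ((hloc (x + 1) (by linarith)) x ⟨hx1, by linarith⟩).mono_of_mem_nhdsWithin ?_
  rw [← Ici_inter_Iic]
  exact inter_mem self_mem_nhdsWithin (mem_nhdsWithin_of_mem_nhds (Iic_mem_nhds (by linarith)))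

lemma tendsto_tailIntegral (hg : IntegrableOn g (Ioi 1)) :
    Tendsto (tailIntegral g) atTop (nhds 0) := by
  have h := intervalIntegral_tendsto_integral_Ioi 1 hg tendsto_id
  have h2 : Tendsto (fun r => tailIntegral g 1 - ∫ ρ in (1 : ℝ)..r, g ρ) atTop
      (nhds (tailIntegral g 1 - tailIntegral g 1)) := tendsto_const_nhds.sub h
  rw [sub_self] at h2
  refine h2.congr' ?_
  filter_upwards [eventually_ge_atTop 1] with r hr
  exact (tailIntegral_eq hg hr).symm

lemma hasDerivAt_tailIntegral (hg : IntegrableOn g (Ioi 1)) (hc : ContinuousOn g (Ioi 1))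
    {r : ℝ} (hr : 1 < r) : HasDerivAt (tailIntegral g) (-g r) r := by
  have h := intervalIntegral.integral_hasDerivAt_right (integrable_segment hg le_rfl hr.le)
    (hc.stronglyMeasurableAtFilter isOpen_Ioi r hr) (hc.continuousAt (Ioi_mem_nhds hr))
  refine (h.const_sub (tailIntegral g 1)).congr_of_eventuallyEq ?_
  filter_upwards [Ioi_mem_nhds hr] with x hx
  exact tailIntegral_eq hg (le_of_lt hx)

lemma tailIntegral_nonneg (h0 : ∀ r, 0 ≤ g r) (r : ℝ) : 0 ≤ tailIntegral g r :=
  integral_nonneg h0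

lemma tailIntegral_antitone (hg : IntegrableOn g (Ioi 1)) (h0 : ∀ r, 0 ≤ g r) {a b : ℝ}
    (ha : 1 ≤ a) (hab : a ≤ b) : tailIntegral g b ≤ tailIntegral g a := by
  have h := tailIntegral_sub hg ha (ha.trans hab)
  have := intervalIntegral.integral_nonneg (μ := volume) hab (fun x _ => h0 x)
  linarith

end Tail

lemma eq_of_hasDerivAt_zero {F : ℝ → ℝ} (hc : ContinuousOn F (Ici 1))
    (hd : ∀ r, 1 < r → HasDerivAt F 0 r) {r : ℝ} (hr : 1 ≤ r) : F r = F 1 := by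
  have h := intervalIntegral.integral_eq_sub_of_hasDeriv_right (a := 1) (b := r) (f := F)
    (f' := fun _ => 0) (hc.mono (by rw [uIcc_of_le hr]; exact Icc_subset_Ici_self))
    (fun x hx => (hd x (by rw [min_eq_left hr] at hx; exact hx.1)).hasDerivWithinAt) (by simp)
  simp only [intervalIntegral.integral_zero] at h
  linarith

lemma eq_zero_of_hasDerivAt_zero_of_tendsto {F : ℝ → ℝ} (hc : ContinuousOn F (Ici 1))
    (hd : ∀ r, 1 < r → HasDerivAt F 0 r) (hF : Tendsto F atTop (nhds 0)) {r : ℝ} (hr : 1 ≤ r) :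
    F r = 0 := by
  rw [eq_of_hasDerivAt_zero hc hd hr]
  refine tendsto_nhds_unique (tendsto_const_nhds.congr' ?_) hF
  filter_upwards [eventually_ge_atTop 1] with x hx
  exact (eq_of_hasDerivAt_zero hc hd hx).symm

/-! ### Inverting a parametrisation -/

/-- A continuous function `N` on `[1, ∞)` factors through an increasing continuous
parametrisation `X` of `[0, l)`; if `N` and `X` have the same limit at infinity, the factor extends
continuously by the identity. -/
lemma exists_continuous_factor {X N : ℝ → ℝ} {l : ℝ} (hX : ContinuousOn X (Ici 1))
    (hXm : StrictMonoOn X (Ici 1)) (hX1 : X 1 = 0) (hXl : Tendsto X atTop (nhds l))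
    (hN : ContinuousOn N (Ici 1)) (hNl : Tendsto N atTop (nhds l)) :
    ∃ η : ℝ → ℝ, Continuous η ∧ (∀ r, 1 ≤ r → η (X r) = N r) ∧ (∀ x, l ≤ x → η x = x) ∧
      (∀ r, 1 ≤ r → X r < l) ∧ (∀ x, 0 ≤ x → x < l → ∃ r, 1 ≤ r ∧ X r = x) := by
  have hlt : ∀ r, 1 ≤ r → X r < l := fun r hr => by
    have h1 : X r < X (r + 1) := hXm hr (by simp; linarith) (by linarith)
    refine lt_of_lt_of_le h1 (ge_of_tendsto hXl ?_)
    filter_upwards [eventually_ge_atTop (r + 1)] with x hx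
    exact hXm.monotoneOn (by simp; linarith) (by simp; linarith) hx
  have hsurj : ∀ x, 0 ≤ x → x < l → ∃ r, 1 ≤ r ∧ X r = x := fun x hx0 hxl => by
    obtain ⟨R, hR1, hR⟩ := ((eventually_ge_atTop 1).and (hXl.eventually (lt_mem_nhds hxl))).exists
    obtain ⟨r, hr, hrx⟩ := intermediate_value_Icc hR1 (hX.mono Icc_subset_Ici_self)
      (show x ∈ Icc (X 1) (X R) from ⟨by rw [hX1]; exact hx0, hR.le⟩)
    exact ⟨r, hr.1, hrx⟩
  have hsurj' : ∀ x : ℝ, ∃ r : ℝ, x < l → (0 ≤ x → 1 ≤ r ∧ X r = x) ∧ (x < 0 → r = 1 + x) := by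
    intro x
    by_cases hx : 0 ≤ x
    · by_cases hxl : x < l
      · obtain ⟨r, hr⟩ := hsurj x hx hxl
        exact ⟨r, fun _ => ⟨fun _ => hr, fun h => absurd hx (not_le.2 h)⟩⟩
      · exact ⟨0, fun h => absurd h hxl⟩
    · exact ⟨1 + x, fun _ => ⟨fun h => absurd h hx, fun _ => rfl⟩⟩
  choose ψ hψ using hsurj'
  have hψX : ∀ r, 1 ≤ r → ψ (X r) = r := fun r hr => by
    have h0 : 0 ≤ X r := by rw [← hX1]; exact hXm.monotoneOn (by simp) hr hr
    have := ((hψ _ (hlt r hr)).1 h0)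
    exact hXm.injOn this.1 hr this.2
  have hψm : StrictMonoOn ψ (Iio l) := by
    intro x hx y hy hxy
    rcases le_or_gt 0 x with h0 | h0
    · have hx' := (hψ x hx).1 h0
      have hy' := (hψ y hy).1 (h0.trans hxy.le)
      by_contra! hcon
      have := hXm.monotoneOn hy'.1 hx'.1 hcon
      rw [hx'.2, hy'.2] at this
      linarith
    · rw [(hψ x hx).2 h0]
      rcases le_or_gt 0 y with h1 | h1
      · linarith [((hψ y hy).1 h1).1]
      · rw [(hψ y hy).2 h1]; linarith
  have hl0 : 0 < l := by rw [← hX1]; exact hlt 1 le_rfl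
  have himg : ψ '' Iio l = univ := by
    refine eq_univ_of_forall fun r => ?_
    rcases le_or_gt 1 r with hr | hr
    · exact ⟨X r, hlt r hr, hψX r hr⟩
    · refine ⟨r - 1, ?_, ?_⟩
      · simp only [mem_Iio]; linarith
      · rw [(hψ (r - 1) (show r - 1 < l by linarith)).2 (by linarith)]; ring
  have hψc : ∀ x, x < l → ContinuousAt ψ x := fun x hx =>
    hψm.continuousAt_of_image_mem_nhds (Iio_mem_nhds hx) (by rw [himg]; exact univ_mem)
  have hN' : Continuous fun r => N (max r 1) :=
    hN.comp_continuous (continuous_id.max continuous_const) (fun r => mem_Ici.2 (le_max_right _ _))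
  have hψtop : Tendsto ψ (nhdsWithin l (Iio l)) atTop := by
    refine tendsto_atTop.2 fun M => ?_
    have hM := hlt (max M 1) (le_max_right _ _)
    filter_upwards [self_mem_nhdsWithin, mem_nhdsWithin_of_mem_nhds (Ioi_mem_nhds hM)] with x hx hMx
    have := hψm hM hx hMx
    rw [hψX _ (le_max_right _ _)] at this
    exact (le_max_left M 1).trans this.le
  refine ⟨fun x => if x < l then N (max (ψ x) 1) else x, ?_, ?_, ?_, hlt, hsurj⟩
  · refine continuous_iff_continuousAt.2 fun x => ?_
    rcases lt_trichotomy x l with hx | hx | hx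
    · refine ((hN'.continuousAt).comp (hψc x hx)).congr ?_
      filter_upwards [Iio_mem_nhds hx] with y hy
      simp only [mem_Iio] at hy
      simp [hy]
    · subst hx
      refine continuousAt_iff_continuous_left'_right'.2 ⟨?_, ?_⟩
      · have h1 : Tendsto (fun y => N (max (ψ y) 1)) (nhdsWithin x (Iio x)) (nhds x) :=
          hNl.comp (tendsto_atTop_mono (fun y => le_max_left _ _) hψtop)
        unfold ContinuousWithinAt
        simp only [lt_irrefl, if_false]
        refine h1.congr' ?_
        filter_upwards [self_mem_nhdsWithin] with y hy
        rw [if_pos (mem_Iio.1 hy)]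
      · refine (continuousWithinAt_id).congr (fun y hy => ?_) (by simp)
        simp only [mem_Ioi] at hy
        simp [not_lt.2 hy.le]
    · refine continuousAt_id.congr ?_
      filter_upwards [Ioi_mem_nhds hx] with y hy
      simp only [mem_Ioi] at hy
      simp [not_lt.2 hy.le]
  · intro r hr
    simp only [hlt r hr, if_true, hψX r hr, max_eq_left hr]
  · intro x hx
    simp [not_lt.2 hx]

/-! ### Energy and mass of radial functions -/

/-- Radial density of `‖∇f‖²_{L²}`. -/
noncomputable def energyDensity (f : ℝ → ℝ) (r : ℝ) : ℝ := (deriv f r) ^ 2 * r ^ 2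

/-- Radial density of `‖f‖^{2(m+1)}_{L^{2(m+1)}}`. -/
noncomputable def massDensity (m : ℕ) (f : ℝ → ℝ) (r : ℝ) : ℝ := |f r| ^ (2 * (m + 1)) * r ^ 2

/-- The scale `S` with `S ^ (2 * (m + 1)) * r ^ 3` equal to the mass outside radius `r`. -/
noncomputable def massScale (m : ℕ) (f : ℝ → ℝ) (r : ℝ) : ℝ :=
  (tailIntegral (massDensity m f) r / r ^ 3) ^ ((1 : ℝ) / (2 * ((m : ℝ) + 1)))

lemma energyDensity_nonneg (f : ℝ → ℝ) (r : ℝ) : 0 ≤ energyDensity f r := by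
  unfold energyDensity; positivity

lemma massDensity_nonneg (m : ℕ) (f : ℝ → ℝ) (r : ℝ) : 0 ≤ massDensity m f r := by
  unfold massDensity; positivity

namespace RadialH10

variable {m : ℕ} {f : ℝ → ℝ}

lemma continuousOn (h : RadialH10 m f) : ContinuousOn f (Ici 1) := h.1

lemma apply_one (h : RadialH10 m f) : f 1 = 0 := h.2.1

lemma hasDerivAt (h : RadialH10 m f) {r : ℝ} (hr : 1 < r) : HasDerivAt f (deriv f r) r :=
  ((h.2.2.1 r hr).differentiableAt (Ioi_mem_nhds hr)).hasDerivAt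

lemma tendsto (h : RadialH10 m f) : Tendsto f atTop (nhds 0) := h.2.2.2.1

lemma integrable_energy (h : RadialH10 m f) : IntegrableOn (energyDensity f) (Ioi 1) :=
  h.2.2.2.2.1

lemma integrable_mass (h : RadialH10 m f) : IntegrableOn (massDensity m f) (Ioi 1) :=
  h.2.2.2.2.2

lemma continuousOn_massDensity (h : RadialH10 m f) :
    ContinuousOn (massDensity m f) (Ici 1) :=
  (h.continuousOn.abs.pow _).mul (continuousOn_id.pow 2)

/-- The radial (Strauss) bound. -/
lemma mul_sq_le (h : RadialH10 m f) {a : ℝ} (ha : 1 ≤ a) :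
    a * f a ^ 2 ≤ tailIntegral (energyDensity f) a := by
  have hR : ∀ R, a ≤ R → a * (f a - f R) ^ 2 ≤ tailIntegral (energyDensity f) a := by
    intro R haR
    have hd : ∀ x ∈ Ioo a R, HasDerivWithinAt (fun r => -(r * (f r - f R) ^ 2))
        (-(1 * (f x - f R) ^ 2 + x * (2 * (f x - f R) * deriv f x))) (Ioi x) x := by
      intro x hx
      have hx1 : 1 < x := ha.trans_lt hx.1
      have h1 := (((h.hasDerivAt hx1).sub_const (f R)).pow 2)
      have h2 := ((hasDerivAt_id x).mul h1).neg
      refine (h2.congr_deriv ?_).hasDerivWithinAt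
      simp
    have hc : ContinuousOn (fun r => -(r * (f r - f R) ^ 2)) (Icc a R) :=
      (continuousOn_id.mul (((h.continuousOn.mono fun x hx => ha.trans hx.1).sub
        continuousOn_const).pow 2)).neg
    have h3 := intervalIntegral.sub_le_integral_of_hasDeriv_right_of_le haR hc hd
      (integrableOn_segment h.integrable_energy ha) (fun x _ => by
        unfold energyDensity
        nlinarith [sq_nonneg (x * deriv f x + (f x - f R))])
    rw [← tailIntegral_sub h.integrable_energy ha (ha.trans haR)] at h3
    have h4 := tailIntegral_nonneg (energyDensity_nonneg f) R
    simp only [sub_self] at h3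
    linarith
  have hlim : Tendsto (fun R => a * (f a - f R) ^ 2) atTop (nhds (a * (f a - 0) ^ 2)) :=
    ((tendsto_const_nhds.sub h.tendsto).pow 2).const_mul a
  rw [sub_zero] at hlim
  refine le_of_tendsto hlim ?_
  filter_upwards [eventually_ge_atTop a] with R hR'
  exact hR R hR'

lemma mass_mul_pow_le (hm : 2 < m) (h : RadialH10 m f) {r : ℝ} (hr : 1 ≤ r) :
    tailIntegral (massDensity m f) r * r ^ m ≤
      tailIntegral (energyDensity f) r ^ (m + 1) * r ^ 2 := by
  set e := tailIntegral (energyDensity f) r with he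
  have he0 : 0 ≤ e := tailIntegral_nonneg (energyDensity_nonneg f) r
  have hr0 : 0 < r := by linarith
  have hpt : ∀ ρ ∈ Ioi r, massDensity m f ρ * r ^ m ≤ e ^ (m + 1) * r ^ 3 * ρ ^ (-2 : ℝ) := by
    intro ρ hρ
    have hρr : r ≤ ρ := le_of_lt hρ
    have hρ0 : 0 < ρ := by linarith
    have h1 : ρ * f ρ ^ 2 ≤ e := (h.mul_sq_le (hr.trans hρr)).trans
      (tailIntegral_antitone h.integrable_energy (energyDensity_nonneg f) hr hρr)
    have h2 : (ρ * f ρ ^ 2) ^ (m + 1) ≤ e ^ (m + 1) := by gcongr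
    have h3 : ρ ^ 3 * r ^ m ≤ r ^ 3 * ρ ^ m := by
      obtain ⟨k, rfl⟩ : ∃ k, m = k + 3 := ⟨m - 3, by omega⟩
      have : r ^ k ≤ ρ ^ k := by gcongr
      calc ρ ^ 3 * r ^ (k + 3) = ρ ^ 3 * r ^ 3 * r ^ k := by ring
        _ ≤ ρ ^ 3 * r ^ 3 * ρ ^ k := by gcongr
        _ = _ := by ring
    have h4 : massDensity m f ρ * ρ ^ (m + 1) = (ρ * f ρ ^ 2) ^ (m + 1) * ρ ^ 2 := by
      unfold massDensity
      rw [pow_mul, sq_abs, mul_pow]; ring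
    have h5 : ρ ^ (-2 : ℝ) = 1 / ρ ^ 2 := by
      rw [Real.rpow_neg hρ0.le]; norm_num
    rw [h5, mul_one_div, le_div_iff₀ (by positivity)]
    have hpos : 0 < ρ ^ (m + 1) := by positivity
    refine le_of_mul_le_mul_right ?_ hpos
    calc massDensity m f ρ * r ^ m * ρ ^ 2 * ρ ^ (m + 1)
        = (ρ * f ρ ^ 2) ^ (m + 1) * (ρ ^ 3 * r ^ m) * ρ := by linear_combination (r ^ m * ρ ^ 2) * h4
      _ ≤ e ^ (m + 1) * (r ^ 3 * ρ ^ m) * ρ := by gcongr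
      _ = _ := by ring
  have hint : IntegrableOn (fun ρ : ℝ => ρ ^ (-2 : ℝ)) (Ioi r) :=
    integrableOn_Ioi_rpow_of_lt (by norm_num) hr0
  have hle := setIntegral_mono_on
    ((h.integrable_mass.mono_set (Ioi_subset_Ioi hr)).mul_const (r ^ m))
    (hint.const_mul (e ^ (m + 1) * r ^ 3)) measurableSet_Ioi hpt
  rw [integral_mul_const, integral_const_mul, integral_Ioi_rpow_of_lt (by norm_num) hr0] at hle
  refine hle.trans (le_of_eq ?_)
  have : r ^ ((-2 : ℝ) + 1) = 1 / r := by
    rw [show (-2 : ℝ) + 1 = -1 by norm_num, Real.rpow_neg_one, one_div]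
  rw [this]
  field_simp
  norm_num

end RadialH10

section MassScale

variable {m : ℕ} {f : ℝ → ℝ}

lemma massTail_nonneg (m : ℕ) (f : ℝ → ℝ) (r : ℝ) : 0 ≤ tailIntegral (massDensity m f) r :=
  tailIntegral_nonneg (massDensity_nonneg m f) r

lemma massScale_nonneg {r : ℝ} (hr : 1 ≤ r) : 0 ≤ massScale m f r := by
  have := massTail_nonneg m f r
  unfold massScale
  positivity

lemma massScale_pow {r : ℝ} (hr : 1 ≤ r) :
    massScale m f r ^ (2 * (m + 1)) = tailIntegral (massDensity m f) r / r ^ 3 := by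
  have := massTail_nonneg m f r
  unfold massScale
  rw [← Real.rpow_natCast, ← Real.rpow_mul (by positivity)]
  push_cast
  rw [one_div_mul_cancel (by positivity), Real.rpow_one]

lemma massScale_pos {r : ℝ} (hr : 1 ≤ r) (h : 0 < tailIntegral (massDensity m f) r) :
    0 < massScale m f r := by
  unfold massScale
  positivity

lemma massTail_pos_of_massScale_pos {r : ℝ} (hr : 1 ≤ r) (h : 0 < massScale m f r) :
    0 < tailIntegral (massDensity m f) r := by
  have h1 := massScale_pow (m := m) (f := f) hr
  have h2 : 0 < tailIntegral (massDensity m f) r / r ^ 3 := by rw [← h1]; positivity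
  exact (div_pos_iff_of_pos_right (by positivity)).1 h2

lemma mul_massScale_sq_le (hm : 2 < m) (h : RadialH10 m f) {r : ℝ} (hr : 1 ≤ r) :
    r * massScale m f r ^ 2 ≤ tailIntegral (energyDensity f) r := by
  refine le_of_pow_le_pow_left₀ (n := m + 1) (by omega)
    (tailIntegral_nonneg (energyDensity_nonneg f) r) ?_
  rw [mul_pow, ← pow_mul, massScale_pow hr]
  have := h.mass_mul_pow_le hm hr
  rw [mul_div_assoc', div_le_iff₀ (by positivity)]
  calc r ^ (m + 1) * tailIntegral (massDensity m f) r
      = (tailIntegral (massDensity m f) r * r ^ m) * r := by ring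
    _ ≤ (tailIntegral (energyDensity f) r ^ (m + 1) * r ^ 2) * r := by gcongr
    _ = _ := by ring

lemma continuousOn_massScale (h : RadialH10 m f) : ContinuousOn (massScale m f) (Ici 1) := by
  refine ContinuousOn.rpow_const ((continuousOn_tailIntegral h.integrable_mass).div
    (continuousOn_id.pow 3) fun x hx => ?_) fun x _ => Or.inr (by positivity)
  exact (pow_pos (zero_lt_one.trans_le hx) 3).ne'

lemma hasDerivAt_massScale (h : RadialH10 m f) {r : ℝ} (hr : 1 < r)
    (hS : 0 < massScale m f r) :
    HasDerivAt (massScale m f) (-(massScale m f r / (2 * ((m : ℝ) + 1) * r) *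
      ((|f r| / massScale m f r) ^ (2 * (m + 1)) + 3))) r := by
  have hr0 : 0 < r := by linarith
  have hz := massTail_pos_of_massScale_pos hr.le hS
  have hz' := hasDerivAt_tailIntegral h.integrable_mass
    (h.continuousOn_massDensity.mono Ioi_subset_Ici_self) hr
  have h1 := hz'.div (hasDerivAt_pow 3 r) (by positivity)
  have h2 := h1.rpow_const (p := (1 : ℝ) / (2 * ((m : ℝ) + 1)))
    (Or.inl (div_pos hz (by positivity : 0 < r ^ 3)).ne')
  refine h2.congr_deriv ?_
  rw [Pi.div_apply, Real.rpow_sub_one (by positivity), div_pow, massScale_pow hr.le]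
  change _ * _ * (massScale m f r / _) = _
  generalize tailIntegral (massDensity m f) r = z at hz ⊢
  unfold massDensity
  field_simp
  ring

/-- The right derivative of `|f|`. -/
noncomputable def absRightDeriv (f : ℝ → ℝ) (r : ℝ) : ℝ :=
  derivWithin (fun x => |f x|) (Ioi r) r

lemma RadialH10.hasDerivWithinAt_abs (h : RadialH10 m f) {r : ℝ} (hr : 1 < r) :
    HasDerivWithinAt (fun x => |f x|) (absRightDeriv f r) (Ioi r) r ∧
      absRightDeriv f r ^ 2 = deriv f r ^ 2 := by
  have key : ∃ d, HasDerivWithinAt (fun x => |f x|) d (Ioi r) r ∧ d ^ 2 = deriv f r ^ 2 := by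
    have hd := h.hasDerivAt hr
    by_cases h0 : f r = 0
    · refine ⟨|deriv f r|, ?_, sq_abs _⟩
      have h1 := (hasDerivAt_iff_tendsto_slope.1 hd).mono_left
        (nhdsWithin_mono r (fun x (hx : r < x) => ne_of_gt hx : Ioi r ⊆ {r}ᶜ))
      rw [hasDerivWithinAt_iff_tendsto_slope' (by simp)]
      refine h1.abs.congr' ?_
      filter_upwards [self_mem_nhdsWithin] with x hx
      have hx' : 0 < x - r := sub_pos.2 hx
      simp only [slope_def_field, h0, abs_div, abs_zero, sub_zero, abs_of_pos hx']
    · rcases lt_or_gt_of_ne h0 with hlt | hgt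
      · exact ⟨-1 * deriv f r, ((hasDerivAt_abs_neg hlt).comp r hd).hasDerivWithinAt, by ring⟩
      · exact ⟨1 * deriv f r, ((hasDerivAt_abs_pos hgt).comp r hd).hasDerivWithinAt, by ring⟩
  obtain ⟨d, hd, hsq⟩ := key
  have : absRightDeriv f r = d := hd.derivWithin (uniqueDiffWithinAt_Ioi r)
  rw [this]
  exact ⟨hd, hsq⟩

/-- If no mass is left outside radius `r`, then `f` vanishes there. -/
lemma RadialH10.eq_zero_of_massTail (h : RadialH10 m f) {r : ℝ} (hr : 1 ≤ r)
    (hz : tailIntegral (massDensity m f) r = 0) {x : ℝ} (hx : r ≤ x) :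
    tailIntegral (massDensity m f) x = 0 ∧ f x = 0 := by
  have hzero : ∀ y, r ≤ y → tailIntegral (massDensity m f) y = 0 := fun y hy =>
    le_antisymm ((tailIntegral_antitone h.integrable_mass (massDensity_nonneg m f) hr hy).trans
      hz.le) (massTail_nonneg m f y)
  have hpos : ∀ y, r < y → f y = 0 := fun y hy => by
    have hy1 : 1 < y := hr.trans_lt hy
    have h1 := hasDerivAt_tailIntegral h.integrable_mass
      (h.continuousOn_massDensity.mono Ioi_subset_Ici_self) hy1
    have h2 : HasDerivAt (tailIntegral (massDensity m f)) 0 y :=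
      (hasDerivAt_const y (0 : ℝ)).congr_of_eventuallyEq (by
        filter_upwards [Ioi_mem_nhds hy] with w hw
        exact hzero w (le_of_lt hw))
    have h3 := h1.unique h2
    unfold massDensity at h3
    have : y ≠ 0 := by linarith
    simpa [this] using h3
  refine ⟨hzero x hx, ?_⟩
  rcases hx.eq_or_lt with rfl | hlt
  · have hc : ContinuousWithinAt f (Ioi r) r :=
      (h.continuousOn r hr).mono fun y (hy : r < y) => hr.trans hy.le
    refine tendsto_nhds_unique hc (tendsto_const_nhds.congr' ?_)
    filter_upwards [self_mem_nhdsWithin] with y hy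
    exact (hpos y hy).symm
  · exact hpos x hlt

lemma RadialH10.energyTail_eq_zero_of_massTail (h : RadialH10 m f) {r : ℝ} (hr : 1 ≤ r)
    (hz : tailIntegral (massDensity m f) r = 0) : tailIntegral (energyDensity f) r = 0 := by
  refine setIntegral_eq_zero_of_forall_eq_zero fun x hx => ?_
  have h2 : HasDerivAt f 0 x := (hasDerivAt_const x (0 : ℝ)).congr_of_eventuallyEq (by
    filter_upwards [Ioi_mem_nhds hx] with w hw
    exact (h.eq_zero_of_massTail hr hz (le_of_lt hw)).2)
  simp [energyDensity, h2.deriv]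

end MassScale

/-! ### Calibrations -/

/-- A solution of the stationary Hamilton–Jacobi equation attached to the Sobolev quotient, in the
scale-invariant variable `x = |f| / S`. -/
structure Calibration (m : ℕ) (χ η : ℝ → ℝ) : Prop where
  continuous_slope : Continuous η
  hasDerivAt : ∀ x, HasDerivAt χ (2 * η x) x
  hamilton_jacobi : ∀ x, 0 ≤ x →
    ((m : ℝ) + 1) * (χ x - η x ^ 2) = (x ^ (2 * (m + 1)) + 3) * (χ x - x * η x)
  nonneg : ∀ x, 0 ≤ x → 0 ≤ χ x
  bound : ∃ C, 0 ≤ C ∧ ∀ x, 0 ≤ x → χ x ≤ C * (1 + x ^ 2)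

/-- The value function of a calibration along `f`. -/
noncomputable def calibrationValue (m : ℕ) (χ f : ℝ → ℝ) (r : ℝ) : ℝ :=
  r * massScale m f r ^ 2 * χ (|f r| / massScale m f r)

lemma hasDerivWithinAt_ratio {m : ℕ} {f : ℝ → ℝ} (h : RadialH10 m f) {r : ℝ} (hr : 1 < r)
    (hS : 0 < massScale m f r) :
    HasDerivWithinAt (fun x => |f x| / massScale m f x)
      (absRightDeriv f r / massScale m f r + |f r| / massScale m f r *
        ((|f r| / massScale m f r) ^ (2 * (m + 1)) + 3) / (2 * ((m : ℝ) + 1) * r)) (Ioi r) r := by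
  have hr0 : 0 < r := by linarith
  have h1 := (h.hasDerivWithinAt_abs hr).1.div (hasDerivAt_massScale h hr hS).hasDerivWithinAt hS.ne'
  refine h1.congr_deriv ?_
  generalize (|f r| / massScale m f r) ^ (2 * (m + 1)) = P
  field_simp
  ring

namespace Calibration

variable {m : ℕ} {χ η f : ℝ → ℝ}

lemma continuous (hc : Calibration m χ η) : Continuous χ :=
  continuous_iff_continuousAt.2 fun x => (hc.hasDerivAt x).continuousAt

lemma hasDerivWithinAt_value (hc : Calibration m χ η) (h : RadialH10 m f) {r : ℝ} (hr : 1 < r)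
    (hS : 0 < massScale m f r) :
    HasDerivWithinAt (calibrationValue m χ f) (-energyDensity f r + (r * absRightDeriv f r +
      massScale m f r * η (|f r| / massScale m f r)) ^ 2) (Ioi r) r := by
  have hr0 : 0 < r := by linarith
  have hx0 : 0 ≤ |f r| / massScale m f r := by positivity
  have hHJ := hc.hamilton_jacobi _ hx0
  have hsq := (h.hasDerivWithinAt_abs hr).2
  have h1 := (hc.hasDerivAt (|f r| / massScale m f r)).comp_hasDerivWithinAt r
    (hasDerivWithinAt_ratio h hr hS)
  have h2 := ((hasDerivAt_id r).mul ((hasDerivAt_massScale h hr hS).pow 2)).hasDerivWithinAt.mul h1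
  refine h2.congr_deriv ?_
  simp only [id, Pi.mul_apply, Pi.pow_apply, energyDensity, Function.comp]
  have hu : massScale m f r * (|f r| / massScale m f r) = |f r| := by field_simp
  generalize |f r| / massScale m f r = x at *
  generalize x ^ (2 * (m + 1)) = P at *
  have hn : ((m : ℝ) + 1) ≠ 0 := by positivity
  have hS' := hS.ne'
  rw [← sub_eq_zero] at hHJ hsq ⊢
  trans massScale m f r ^ 2 / ((m : ℝ) + 1) * ((m + 1) * (χ x - η x ^ 2) -
    (P + 3) * (χ x - x * η x)) - r ^ 2 * (absRightDeriv f r ^ 2 - deriv f r ^ 2)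
  · field_simp
    ring
  · rw [hHJ, hsq]; ring

lemma value_nonneg (hc : Calibration m χ η) {r : ℝ} (hr : 1 ≤ r) :
    0 ≤ calibrationValue m χ f r := by
  have h1 := massScale_nonneg (m := m) (f := f) hr
  have h2 := hc.nonneg (|f r| / massScale m f r) (by positivity)
  unfold calibrationValue
  positivity

lemma value_bound (hc : Calibration m χ η) (hm : 2 < m) (h : RadialH10 m f) :
    ∃ C, ∀ r, 1 ≤ r → calibrationValue m χ f r ≤ C * tailIntegral (energyDensity f) r := by
  obtain ⟨C, hC0, hC⟩ := hc.bound
  refine ⟨2 * C, fun r hr => ?_⟩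
  have h1 := massScale_nonneg (m := m) (f := f) hr
  have h2 := mul_massScale_sq_le hm h hr
  have h3 := h.mul_sq_le hr
  have h4 := tailIntegral_nonneg (energyDensity_nonneg f) r
  have h5 := hC (|f r| / massScale m f r) (by positivity)
  unfold calibrationValue
  rcases h1.eq_or_lt with h0 | h0
  · rw [← h0]; simp; positivity
  · calc r * massScale m f r ^ 2 * χ (|f r| / massScale m f r)
        ≤ r * massScale m f r ^ 2 * (C * (1 + (|f r| / massScale m f r) ^ 2)) := by gcongr
      _ = C * (r * massScale m f r ^ 2 + r * f r ^ 2) := by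
        rw [div_pow, sq_abs]; field_simp
      _ ≤ C * (tailIntegral (energyDensity f) r + tailIntegral (energyDensity f) r) := by gcongr
      _ = _ := by ring

lemma value_eq_zero {r : ℝ} (hS : massScale m f r = 0) : calibrationValue m χ f r = 0 := by
  simp [calibrationValue, hS]

lemma massTail_eq_zero {r : ℝ} (hr : 1 ≤ r) (hS : ¬ 0 < massScale m f r) :
    tailIntegral (massDensity m f) r = 0 :=
  le_antisymm (not_lt.1 fun hlt => hS (massScale_pos hr hlt)) (massTail_nonneg m f r)

lemma continuousOn_value (hc : Calibration m χ η) (hm : 2 < m) (h : RadialH10 m f) :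
    ContinuousOn (calibrationValue m χ f) (Ici 1) := by
  intro r hr
  have hr1 : (1 : ℝ) ≤ r := hr
  by_cases hS : 0 < massScale m f r
  · have hSc := continuousOn_massScale h r hr
    exact (continuousWithinAt_id.mul (hSc.pow 2)).mul
      ((hc.continuous.continuousAt).comp_continuousWithinAt
        ((h.continuousOn.abs r hr).div hSc hS.ne'))
  · have hS0 : massScale m f r = 0 := le_antisymm (not_lt.1 hS) (massScale_nonneg hr1)
    obtain ⟨C, hC⟩ := hc.value_bound hm h
    have he := h.energyTail_eq_zero_of_massTail hr1 (massTail_eq_zero hr1 hS)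
    have hlim : Tendsto (fun x => C * tailIntegral (energyDensity f) x) (nhdsWithin r (Ici 1))
        (nhds (C * tailIntegral (energyDensity f) r)) :=
      (continuousOn_tailIntegral h.integrable_energy r hr).const_mul C
    unfold ContinuousWithinAt
    rw [value_eq_zero hS0]
    rw [he, mul_zero] at hlim
    refine tendsto_of_tendsto_of_tendsto_of_le_of_le' tendsto_const_nhds hlim ?_ ?_
    · filter_upwards [self_mem_nhdsWithin] with x hx
      exact hc.value_nonneg hx
    · filter_upwards [self_mem_nhdsWithin] with x hx
      exact hC x hx

lemma value_sub_le (hc : Calibration m χ η) (hm : 2 < m) (h : RadialH10 m f) {a b : ℝ}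
    (ha : 1 ≤ a) (hab : a ≤ b) : calibrationValue m χ f a - calibrationValue m χ f b ≤
      tailIntegral (energyDensity f) a - tailIntegral (energyDensity f) b := by
  have hd : ∀ x ∈ Ioo a b, ∃ d, HasDerivWithinAt (fun r => -calibrationValue m χ f r) d (Ioi x) x ∧
      d ≤ energyDensity f x := by
    intro x hx
    have hx1 : 1 < x := ha.trans_lt hx.1
    by_cases hS : 0 < massScale m f x
    · refine ⟨_, (hc.hasDerivWithinAt_value h hx1 hS).neg, ?_⟩
      linarith [sq_nonneg (x * absRightDeriv f x + massScale m f x * η (|f x| / massScale m f x))]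
    · have hV : ∀ y, x ≤ y → calibrationValue m χ f y = 0 := fun y hy => by
        have h1 := (h.eq_zero_of_massTail hx1.le (massTail_eq_zero hx1.le hS) hy).1
        refine value_eq_zero ?_
        unfold massScale
        rw [h1, zero_div, Real.zero_rpow (by positivity)]
      refine ⟨0, (hasDerivWithinAt_const x _ (0 : ℝ)).congr (fun y hy => ?_) ?_,
        energyDensity_nonneg f x⟩
      · rw [hV y (le_of_lt hy), neg_zero]
      · rw [hV x le_rfl, neg_zero]
  choose! d hd1 hd2 using hd
  have h3 := intervalIntegral.sub_le_integral_of_hasDeriv_right_of_le hab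
    ((hc.continuousOn_value hm h).neg.mono fun x hx => ha.trans hx.1) hd1
    (integrableOn_segment h.integrable_energy ha) hd2
  rw [← tailIntegral_sub h.integrable_energy ha (ha.trans hab)] at h3
  simp only [Pi.neg_apply] at h3
  linarith

lemma value_le (hc : Calibration m χ η) (hm : 2 < m) (h : RadialH10 m f) {a : ℝ} (ha : 1 ≤ a) :
    calibrationValue m χ f a ≤ tailIntegral (energyDensity f) a := by
  obtain ⟨C, hC⟩ := hc.value_bound hm h
  have hlim := ((tendsto_tailIntegral h.integrable_energy).const_mul (C - 1)).const_add
    (tailIntegral (energyDensity f) a)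
  rw [mul_zero, add_zero] at hlim
  refine ge_of_tendsto hlim ?_
  filter_upwards [eventually_ge_atTop a] with b hb
  linarith [hc.value_sub_le hm h ha hb, hC b (ha.trans hb)]

/-- Equality in the calibration inequality forces `f` to follow the calibrating field. -/
lemma ae_eq_field (hc : Calibration m χ η) (hm : 2 < m) (h : RadialH10 m f)
    (heq : calibrationValue m χ f 1 = tailIntegral (energyDensity f) 1) {a b : ℝ}
    (ha : 1 ≤ a) (hab : a ≤ b) (hS : ∀ x ∈ Icc a b, 0 < massScale m f x) :
    ∀ᵐ r ∂(volume.restrict (Ioc a b)),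
      r * absRightDeriv f r + massScale m f r * η (|f r| / massScale m f r) = 0 := by
  have hb : 1 ≤ b := ha.trans hab
  have hV : ∀ r, 1 ≤ r → calibrationValue m χ f r = tailIntegral (energyDensity f) r :=
    fun r hr => le_antisymm (hc.value_le hm h hr)
      (by linarith [hc.value_sub_le hm h le_rfl hr])
  have hsub : Icc a b ⊆ Ici 1 := fun x hx => ha.trans hx.1
  have hSc := (continuousOn_massScale h).mono hsub
  have hηc : ContinuousOn (fun r => massScale m f r * η (|f r| / massScale m f r)) (Icc a b) :=
    hSc.mul (hc.continuous_slope.comp_continuousOn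
      ((h.continuousOn.abs.mono hsub).div hSc fun x hx => (hS x hx).ne'))
  set w := fun r => massScale m f r * η (|f r| / massScale m f r) with hw
  have hEint := integrable_segment h.integrable_energy ha hb
  have hEneg : IntervalIntegrable (fun r => -energyDensity f r) volume a b := hEint.neg
  have hsqint : IntervalIntegrable (fun r => (r * absRightDeriv f r) ^ 2) volume a b := by
    refine hEint.congr_ae ?_
    rw [uIoc_of_le hab]
    filter_upwards [ae_restrict_mem measurableSet_Ioc] with r hr
    rw [mul_pow, (h.hasDerivWithinAt_abs (ha.trans_lt hr.1)).2, energyDensity, mul_comm]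
  have hmeas : AEStronglyMeasurable (fun r => r * absRightDeriv f r) (volume.restrict (Ioc a b)) :=
    (measurable_id.mul (measurable_derivWithin_Ioi _)).aestronglyMeasurable
  have hL2 : MemLp (fun r => r * absRightDeriv f r) 2 (volume.restrict (Ioc a b)) :=
    (memLp_two_iff_integrable_sq hmeas).2
      ((intervalIntegrable_iff_integrableOn_Ioc_of_le hab).1 hsqint)
  have hw2 : MemLp w 2 (volume.restrict (Ioc a b)) := by
    refine (memLp_two_iff_integrable_sq
      ((hηc.mono Ioc_subset_Icc_self).aestronglyMeasurable measurableSet_Ioc)).2 ?_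
    exact ((hηc.pow 2).integrableOn_Icc).mono_set Ioc_subset_Icc_self
  have hsum : IntervalIntegrable (fun r => (r * absRightDeriv f r + w r) ^ 2) volume a b :=
    (intervalIntegrable_iff_integrableOn_Ioc_of_le hab).2 (hL2.add hw2).integrable_sq
  have hFTC := intervalIntegral.integral_eq_sub_of_hasDeriv_right
    (f := calibrationValue m χ f) (a := a) (b := b)
    (f' := fun r => -energyDensity f r + (r * absRightDeriv f r + w r) ^ 2)
    ((hc.continuousOn_value hm h).mono (by rw [uIcc_of_le hab]; exact hsub))
    (fun x hx => by
      rw [min_eq_left hab, max_eq_right hab] at hx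
      exact hc.hasDerivWithinAt_value h (ha.trans_lt hx.1) (hS x ⟨hx.1.le, hx.2.le⟩))
    (hEneg.add hsum)
  rw [intervalIntegral.integral_add hEneg hsum, intervalIntegral.integral_neg,
    ← tailIntegral_sub h.integrable_energy ha hb, hV a ha, hV b hb] at hFTC
  have hzero : ∫ r in Ioc a b, (r * absRightDeriv f r + w r) ^ 2 = 0 := by
    rw [← intervalIntegral.integral_of_le hab]; linarith
  have h0 := (integral_eq_zero_iff_of_nonneg (fun r => sq_nonneg _)
    (hL2.add hw2).integrable_sq).1 hzero
  filter_upwards [h0] with r hr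
  simpa using hr

end Calibration

/-! ### The ground state -/

/-- A positive radial solution of `-ΔQ = |Q|^{2m} Q` on `{|x| > 1}` vanishing on the boundary. -/
structure IsGroundState (m : ℕ) (Q : ℝ → ℝ) : Prop where
  mem : RadialH10 m Q
  contDiffOn : ContDiffOn ℝ 2 Q (Ioi 1)
  equation : ∀ r : ℝ, 1 < r →
    deriv (deriv Q) r + (2 / r) * deriv Q r + |Q r| ^ (2 * m) * Q r = 0
  pos : ∀ r : ℝ, 1 < r → 0 < Q r

/-- The flux `r² Q'(r)`, extended continuously to `r = 1`. -/
noncomputable def flux (m : ℕ) (Q : ℝ → ℝ) (r : ℝ) : ℝ :=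
  4 * deriv Q 2 + ∫ ρ in r..2, ρ ^ 2 * Q ρ ^ (2 * m + 1)

namespace IsGroundState

variable {m : ℕ} {Q : ℝ → ℝ}

lemma nonneg (h : IsGroundState m Q) {r : ℝ} (hr : 1 ≤ r) : 0 ≤ Q r := by
  rcases hr.eq_or_lt with rfl | hr
  · rw [h.mem.apply_one]
  · exact (h.pos r hr).le

lemma abs_eq (h : IsGroundState m Q) {r : ℝ} (hr : 1 ≤ r) : |Q r| = Q r :=
  abs_of_nonneg (h.nonneg hr)

lemma continuousOn_source (h : IsGroundState m Q) :
    ContinuousOn (fun ρ : ℝ => ρ ^ 2 * Q ρ ^ (2 * m + 1)) (Ici 1) :=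
  (continuousOn_id.pow 2).mul (h.mem.continuousOn.pow _)

lemma hasDerivAt_sq_mul_deriv (h : IsGroundState m Q) {r : ℝ} (hr : 1 < r) :
    HasDerivAt (fun ρ => ρ ^ 2 * deriv Q ρ) (-(r ^ 2 * Q r ^ (2 * m + 1))) r := by
  have h1 : ContDiffOn ℝ 1 (deriv Q) (Ioi 1) :=
    h.contDiffOn.deriv_of_isOpen isOpen_Ioi (by norm_num)
  have h2 : HasDerivAt (deriv Q) (deriv (deriv Q) r) r :=
    ((h1.differentiableOn (by norm_num) r hr).differentiableAt (Ioi_mem_nhds hr)).hasDerivAt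
  have h3 := h.equation r hr
  rw [h.abs_eq hr.le] at h3
  have hr0 : r ≠ 0 := by linarith
  refine ((hasDerivAt_pow 2 r).mul h2).congr_deriv ?_
  have h4 : deriv (deriv Q) r = -((2 / r) * deriv Q r + Q r ^ (2 * m) * Q r) := by linarith
  rw [h4]
  field_simp
  push_cast
  ring

lemma flux_eq (h : IsGroundState m Q) {r : ℝ} (hr : 1 < r) : flux m Q r = r ^ 2 * deriv Q r := by
  have hsub : uIcc r 2 ⊆ Ioi 1 := fun x hx =>
    lt_of_lt_of_le (lt_min hr (by norm_num)) hx.1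
  have h1 := intervalIntegral.integral_eq_sub_of_hasDerivAt (a := r) (b := 2)
    (f := fun ρ => ρ ^ 2 * deriv Q ρ) (fun x hx => h.hasDerivAt_sq_mul_deriv (hsub hx))
    ((h.continuousOn_source.mono (hsub.trans Ioi_subset_Ici_self)).neg.intervalIntegrable)
  rw [intervalIntegral.integral_neg] at h1
  unfold flux
  linarith

lemma hasDerivAt_flux (h : IsGroundState m Q) {r : ℝ} (hr : 1 < r) :
    HasDerivAt (flux m Q) (-(r ^ 2 * Q r ^ (2 * m + 1))) r :=
  (h.hasDerivAt_sq_mul_deriv hr).congr_of_eventuallyEq (by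
    filter_upwards [Ioi_mem_nhds hr] with x hx
    exact h.flux_eq hx)

lemma hasDerivAt (h : IsGroundState m Q) {r : ℝ} (hr : 1 < r) :
    HasDerivAt Q (flux m Q r / r ^ 2) r := by
  have hr0 : r ≠ 0 := by linarith
  rw [h.flux_eq hr, mul_div_cancel_left₀ _ (pow_ne_zero 2 hr0)]
  exact h.mem.hasDerivAt hr

lemma continuousOn_flux (h : IsGroundState m Q) : ContinuousOn (flux m Q) (Ici 1) := by
  intro r hr
  have hr1 : (1 : ℝ) ≤ r := hr
  rcases hr1.eq_or_lt with rfl | hlt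
  · have hsub : uIcc (1 : ℝ) 2 ⊆ Ici 1 := by
      rw [uIcc_of_le (by norm_num)]; exact Icc_subset_Ici_self
    have h1 : ContinuousOn (flux m Q) (uIcc 1 2) := by
      refine continuousOn_const.add ?_
      refine (intervalIntegral.continuousOn_primitive_interval'
        ((h.continuousOn_source.mono hsub).intervalIntegrable (μ := volume)) right_mem_uIcc).neg.congr
        fun x _ => ?_
      rw [intervalIntegral.integral_symm]; rfl
    rw [uIcc_of_le (by norm_num)] at h1
    refine (h1 1 (by norm_num)).mono_of_mem_nhdsWithin ?_
    rw [← Ici_inter_Iic]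
    exact inter_mem self_mem_nhdsWithin (mem_nhdsWithin_of_mem_nhds (Iic_mem_nhds (by norm_num)))
  · exact (h.hasDerivAt_flux hlt).continuousAt.continuousWithinAt

lemma strictAntiOn_flux (h : IsGroundState m Q) : StrictAntiOn (flux m Q) (Ici 1) := by
  refine strictAntiOn_of_deriv_neg (convex_Ici 1) h.continuousOn_flux fun x hx => ?_
  rw [interior_Ici] at hx
  have hx1 : 1 < x := hx
  rw [(h.hasDerivAt_flux hx1).deriv]
  have := h.pos x hx1
  have : 0 < x := by linarith
  rw [neg_lt_zero]
  positivity

lemma flux_one_pos (h : IsGroundState m Q) : 0 < flux m Q 1 := by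
  by_contra! hcon
  have h1 : AntitoneOn Q (Ici 1) := by
    refine antitoneOn_of_deriv_nonpos (convex_Ici 1) h.mem.continuousOn (fun x hx => ?_)
      fun x hx => ?_
    · rw [interior_Ici] at hx
      exact (h.hasDerivAt hx).differentiableAt.differentiableWithinAt
    · rw [interior_Ici] at hx
      have hx1 : 1 < x := hx
      rw [(h.hasDerivAt hx1).deriv]
      have := h.strictAntiOn_flux (by simp) hx1.le hx1
      exact div_nonpos_of_nonpos_of_nonneg (by linarith) (by positivity)
  have h2 := h1 (by simp : (1 : ℝ) ∈ Ici 1) (by simp : (2 : ℝ) ∈ Ici 1) (by norm_num)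
  rw [h.mem.apply_one] at h2
  linarith [h.pos 2 (by norm_num)]

lemma eventually_flux_neg (h : IsGroundState m Q) : ∀ᶠ r in atTop, flux m Q r < 0 := by
  have hex : ∃ r, 1 < r ∧ flux m Q r < 0 := by
    by_contra! hcon
    have h1 : MonotoneOn Q (Ici 1) := by
      refine monotoneOn_of_deriv_nonneg (convex_Ici 1) h.mem.continuousOn (fun x hx => ?_)
        fun x hx => ?_
      · rw [interior_Ici] at hx
        exact (h.hasDerivAt hx).differentiableAt.differentiableWithinAt
      · rw [interior_Ici] at hx
        rw [(h.hasDerivAt hx).deriv]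
        exact div_nonneg (hcon x hx) (by positivity)
    have h2 : Q 2 ≤ 0 := by
      refine ge_of_tendsto h.mem.tendsto ?_
      filter_upwards [eventually_ge_atTop 2] with x hx
      exact h1 (by simp) (by simp; linarith) hx
    linarith [h.pos 2 (by norm_num)]
  obtain ⟨r, hr1, hr⟩ := hex
  filter_upwards [eventually_ge_atTop r] with x hx
  exact lt_of_le_of_lt (h.strictAntiOn_flux.antitoneOn hr1.le (hr1.le.trans hx) hx) hr

/-- `r Q` is nondecreasing. -/
lemma neg_flux_le (h : IsGroundState m Q) {r : ℝ} (hr : 1 < r) : -flux m Q r ≤ r * Q r := by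
  by_contra! hcon
  have hr0 : 0 < r := by linarith
  set D : ℝ → ℝ := fun x => Q x + flux m Q x / x with hD
  have hDd : ∀ x, 1 < x → HasDerivAt D (-(x * Q x ^ (2 * m + 1))) x := fun x hx => by
    have hx0 : x ≠ 0 := by linarith
    refine ((h.hasDerivAt hx).add ((h.hasDerivAt_flux hx).div (hasDerivAt_id x) hx0)).congr_deriv ?_
    simp only [id]
    field_simp
    ring
  have hDr : D r < 0 := by
    have : D r = (r * Q r + flux m Q r) / r := by rw [hD]; field_simp
    rw [this]
    exact div_neg_of_neg_of_pos (by linarith) hr0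
  have hDanti : AntitoneOn D (Ici r) := by
    refine antitoneOn_of_deriv_nonpos (convex_Ici r)
      (fun x hx => (hDd x (hr.trans_le hx)).continuousAt.continuousWithinAt) (fun x hx => ?_)
      fun x hx => ?_
    · rw [interior_Ici] at hx
      exact (hDd x (hr.trans hx)).differentiableAt.differentiableWithinAt
    · rw [interior_Ici] at hx
      have hx1 : 1 < x := hr.trans hx
      rw [(hDd x hx1).deriv, neg_nonpos]
      have := (h.pos x hx1)
      have : 0 < x := by linarith
      positivity
  have hw : ∀ x, 1 < x → HasDerivAt (fun y => y * Q y) (D x) x := fun x hx => by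
    have hx0 : x ≠ 0 := by linarith
    refine ((hasDerivAt_id x).mul (h.hasDerivAt hx)).congr_deriv ?_
    simp only [id, hD]
    field_simp
  have hle : ∀ y, r ≤ y → y * Q y - r * Q r ≤ D r * (y - r) := fun y hy =>
    (convex_Ici r).image_sub_le_mul_sub_of_deriv_le (f := fun y => y * Q y)
      (fun x hx => (hw x (hr.trans_le hx)).continuousAt.continuousWithinAt)
      (fun x hx => (hw x (by rw [interior_Ici] at hx; exact hr.trans hx)).differentiableAt
        |>.differentiableWithinAt)
      (fun x hx => by
        rw [interior_Ici] at hx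
        rw [(hw x (hr.trans hx)).deriv]
        exact hDanti self_mem_Ici (mem_Ici.2 (le_of_lt hx)) (le_of_lt hx)) r self_mem_Ici y hy hy
  have hQr := h.pos r hr
  have hy : r ≤ r + r * Q r / (-D r) := le_add_of_nonneg_right
    (div_nonneg (by positivity) (by linarith))
  have h1 := hle _ hy
  have h2 : D r * (r + r * Q r / (-D r) - r) = -(r * Q r) := by
    have := hDr.ne
    field_simp
    ring
  rw [h2] at h1
  have h3 := h.pos _ (hr.trans_le hy)
  have : 0 < (r + r * Q r / (-D r)) * Q (r + r * Q r / (-D r)) := by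
    have : 0 < r + r * Q r / (-D r) := by linarith
    positivity
  linarith

lemma massDensity_eq (h : IsGroundState m Q) {r : ℝ} (hr : 1 ≤ r) :
    massDensity m Q r = Q r ^ (2 * (m + 1)) * r ^ 2 := by
  rw [massDensity, h.abs_eq hr]

lemma hasDerivAt_massTail (h : IsGroundState m Q) {r : ℝ} (hr : 1 < r) :
    HasDerivAt (tailIntegral (massDensity m Q)) (-(Q r ^ (2 * (m + 1)) * r ^ 2)) r := by
  rw [← h.massDensity_eq hr.le]
  exact hasDerivAt_tailIntegral h.mem.integrable_mass
    (h.mem.continuousOn_massDensity.mono Ioi_subset_Ici_self) hr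

lemma hasDerivAt_energyTail (h : IsGroundState m Q) {r : ℝ} (hr : 1 < r) :
    HasDerivAt (tailIntegral (energyDensity Q)) (-(flux m Q r ^ 2 / r ^ 2)) r := by
  have h1 := hasDerivAt_tailIntegral h.mem.integrable_energy
    (((h.contDiffOn.continuousOn_deriv_of_isOpen isOpen_Ioi (by norm_num)).pow 2).mul
      (continuousOn_id.pow 2)) hr
  have hr0 : r ≠ 0 := by linarith
  refine h1.congr_deriv ?_
  rw [h.flux_eq hr, energyDensity]
  field_simp

lemma massTail_pos (h : IsGroundState m Q) {r : ℝ} (hr : 1 ≤ r) :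
    0 < tailIntegral (massDensity m Q) r := by
  refine (massTail_nonneg m Q r).lt_of_ne fun h0 => ?_
  have := (h.mem.eq_zero_of_massTail hr h0.symm (x := r + 1) (by linarith)).2
  linarith [h.pos (r + 1) (by linarith)]

lemma scale_pos (h : IsGroundState m Q) {r : ℝ} (hr : 1 ≤ r) : 0 < massScale m Q r :=
  massScale_pos hr (h.massTail_pos hr)

lemma tendsto_mul_sq (h : IsGroundState m Q) : Tendsto (fun r => r * Q r ^ 2) atTop (nhds 0) := by
  refine tendsto_of_tendsto_of_tendsto_of_le_of_le' tendsto_const_nhds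
    (tendsto_tailIntegral h.mem.integrable_energy) ?_ ?_
  · filter_upwards [eventually_ge_atTop 1] with r hr
    positivity
  · filter_upwards [eventually_ge_atTop 1] with r hr
    exact h.mem.mul_sq_le hr

lemma tendsto_sq_mul_pow (hm : 2 < m) (h : IsGroundState m Q) :
    Tendsto (fun r => r ^ 2 * Q r ^ (2 * m)) atTop (nhds 0) := by
  have h1 := h.tendsto_mul_sq.pow m
  rw [zero_pow (by omega)] at h1
  refine tendsto_of_tendsto_of_tendsto_of_le_of_le' tendsto_const_nhds h1 ?_ ?_
  · filter_upwards [eventually_ge_atTop 1] with r hr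
    have := h.nonneg hr
    positivity
  · filter_upwards [eventually_ge_atTop 1] with r hr
    have := h.nonneg hr
    rw [mul_pow, ← pow_mul]
    gcongr

lemma tendsto_cube_mul_pow (hm : 2 < m) (h : IsGroundState m Q) :
    Tendsto (fun r => r ^ 3 * Q r ^ (2 * (m + 1))) atTop (nhds 0) := by
  have h1 := (h.tendsto_sq_mul_pow hm).mul h.tendsto_mul_sq
  rw [mul_zero] at h1
  exact h1.congr fun r => by ring

lemma tendsto_mul_flux (h : IsGroundState m Q) :
    Tendsto (fun r => Q r * flux m Q r) atTop (nhds 0) := by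
  have h1 := h.tendsto_mul_sq.neg
  rw [neg_zero] at h1
  refine tendsto_of_tendsto_of_tendsto_of_le_of_le' h1 tendsto_const_nhds ?_ ?_
  · filter_upwards [eventually_gt_atTop 1] with r hr
    nlinarith [h.neg_flux_le hr, h.pos r hr]
  · filter_upwards [eventually_gt_atTop 1, h.eventually_flux_neg] with r hr hW
    exact mul_nonpos_of_nonneg_of_nonpos (h.pos r hr).le hW.le

lemma tendsto_flux_sq (h : IsGroundState m Q) :
    Tendsto (fun r => flux m Q r ^ 2 / r) atTop (nhds 0) := by
  refine tendsto_of_tendsto_of_tendsto_of_le_of_le' tendsto_const_nhds h.tendsto_mul_sq ?_ ?_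
  · filter_upwards [eventually_gt_atTop 1] with r hr
    positivity
  · filter_upwards [eventually_gt_atTop 1, h.eventually_flux_neg] with r hr hW
    have h1 := h.neg_flux_le hr
    rw [div_le_iff₀ (by linarith)]
    nlinarith [h.pos r hr]

/-- The energy identity on `{|x| > r}`. -/
lemma energy_identity (h : IsGroundState m Q) {r : ℝ} (hr : 1 ≤ r) :
    tailIntegral (energyDensity Q) r =
      tailIntegral (massDensity m Q) r - Q r * flux m Q r := by
  have key := eq_zero_of_hasDerivAt_zero_of_tendsto (F := fun r => tailIntegral (energyDensity Q) r -
    (tailIntegral (massDensity m Q) r - Q r * flux m Q r))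
    ((continuousOn_tailIntegral h.mem.integrable_energy).sub
      ((continuousOn_tailIntegral h.mem.integrable_mass).sub
        (h.mem.continuousOn.mul h.continuousOn_flux)))
    (fun x hx => by
      refine ((h.hasDerivAt_energyTail hx).sub ((h.hasDerivAt_massTail hx).sub
        ((h.hasDerivAt hx).mul (h.hasDerivAt_flux hx)))).congr_deriv ?_
      ring)
    (by
      have := (tendsto_tailIntegral h.mem.integrable_energy).sub
        ((tendsto_tailIntegral h.mem.integrable_mass).sub h.tendsto_mul_flux)
      simpa using this) hr
  linarith

/-- The Pohozaev identity on `{|x| > r}`. -/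
lemma pohozaev (hm : 2 < m) (h : IsGroundState m Q) {r : ℝ} (hr : 1 ≤ r) :
    ((m : ℝ) - 2) * tailIntegral (massDensity m Q) r =
      ((m : ℝ) + 1) * (flux m Q r ^ 2 / r + Q r * flux m Q r) + r ^ 3 * Q r ^ (2 * (m + 1)) := by
  have key := eq_zero_of_hasDerivAt_zero_of_tendsto
    (F := fun r => ((m : ℝ) - 2) * tailIntegral (massDensity m Q) r -
      (((m : ℝ) + 1) * (flux m Q r ^ 2 / r + Q r * flux m Q r) + r ^ 3 * Q r ^ (2 * (m + 1))))
    (((continuousOn_tailIntegral h.mem.integrable_mass).const_smul ((m : ℝ) - 2)).sub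
      (((((h.continuousOn_flux.pow 2).div continuousOn_id fun x (hx : (1 : ℝ) ≤ x) =>
        (zero_lt_one.trans_le hx).ne').add
        (h.mem.continuousOn.mul h.continuousOn_flux)).const_smul ((m : ℝ) + 1)).add
        ((continuousOn_id.pow 3).mul (h.mem.continuousOn.pow _))))
    (fun x hx => by
      have hx0 : x ≠ 0 := by linarith
      refine (((h.hasDerivAt_massTail hx).const_mul ((m : ℝ) - 2)).sub
        ((((((h.hasDerivAt_flux hx).pow 2).div (hasDerivAt_id x) hx0).add
        ((h.hasDerivAt hx).mul (h.hasDerivAt_flux hx))).const_mul ((m : ℝ) + 1)).add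
        ((hasDerivAt_pow 3 x).mul ((h.hasDerivAt hx).pow (2 * (m + 1)))))).congr_deriv ?_
      simp only [id, show 2 * (m + 1) - 1 = 2 * m + 1 by omega, Pi.pow_apply]
      push_cast
      field_simp
      ring)
    (by
      have := ((tendsto_tailIntegral h.mem.integrable_mass).const_mul ((m : ℝ) - 2)).sub
        (((h.tendsto_flux_sq.add h.tendsto_mul_flux).const_mul ((m : ℝ) + 1)).add
          (h.tendsto_cube_mul_pow hm))
      simpa using this) hr
  linarith

/-- The logarithmic slope `r Q' / Q`. -/
noncomputable def logSlope (m : ℕ) (Q : ℝ → ℝ) (r : ℝ) : ℝ := flux m Q r / (r * Q r)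

lemma hasDerivAt_logSlope (hm : 2 < m) (h : IsGroundState m Q) {r : ℝ} (hr : 1 < r) :
    HasDerivAt (logSlope m Q) (-((((m : ℝ) - 2) * tailIntegral (massDensity m Q) r +
      m * (r ^ 3 * Q r ^ (2 * (m + 1)))) / (((m : ℝ) + 1) * (r * Q r) ^ 2))) r := by
  have hQ := h.pos r hr
  have hr0 : 0 < r := by linarith
  refine ((h.hasDerivAt_flux hr).div ((hasDerivAt_id r).mul (h.hasDerivAt hr))
    (by simp only [id, Pi.mul_apply]; positivity)).congr_deriv ?_
  rw [h.pohozaev hm hr.le]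
  simp only [id, Pi.mul_apply]
  field_simp
  ring

lemma logSlope_deriv_neg (hm : 2 < m) (h : IsGroundState m Q) {r : ℝ} (hr : 1 < r) :
    -((((m : ℝ) - 2) * tailIntegral (massDensity m Q) r +
      m * (r ^ 3 * Q r ^ (2 * (m + 1)))) / (((m : ℝ) + 1) * (r * Q r) ^ 2)) < 0 := by
  have hQ := h.pos r hr
  have hr0 : 0 < r := by linarith
  have hZ := h.massTail_pos hr.le
  have hm' : (2 : ℝ) < m := by exact_mod_cast hm
  have : 0 < (m : ℝ) - 2 := by linarith
  rw [neg_lt_zero]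
  positivity

lemma neg_one_le_logSlope (h : IsGroundState m Q) {r : ℝ} (hr : 1 < r) :
    -1 ≤ logSlope m Q r := by
  have hQ := h.pos r hr
  have hr0 : 0 < r := by linarith
  rw [logSlope, le_div_iff₀ (by positivity)]
  linarith [h.neg_flux_le hr]

lemma eventually_logSlope_neg (h : IsGroundState m Q) : ∀ᶠ r in atTop, logSlope m Q r < 0 := by
  filter_upwards [h.eventually_flux_neg, eventually_gt_atTop 1] with r hr hr1
  have hQ := h.pos r hr1
  have hr0 : 0 < r := by linarith
  exact div_neg_of_neg_of_pos hr (by positivity)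

/-- The identity `(m - 2) Z / (r Q²) = (m + 1) (y² + y) + r² Q^{2m}`, with `y = r Q' / Q`. -/
lemma pohozaev_logSlope (hm : 2 < m) (h : IsGroundState m Q) {r : ℝ} (hr : 1 < r) :
    ((m : ℝ) - 2) * (tailIntegral (massDensity m Q) r / (r * Q r ^ 2)) =
      ((m : ℝ) + 1) * (logSlope m Q r ^ 2 + logSlope m Q r) + r ^ 2 * Q r ^ (2 * m) := by
  have hQ := h.pos r hr
  have hr0 : 0 < r := by linarith
  rw [mul_div_assoc', h.pohozaev hm hr.le, logSlope]
  field_simp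
  ring

lemma antitoneOn_logSlope (hm : 2 < m) (h : IsGroundState m Q) :
    AntitoneOn (logSlope m Q) (Ioi 1) := by
  refine antitoneOn_of_deriv_nonpos (convex_Ioi 1)
    (fun x hx => (h.hasDerivAt_logSlope hm hx).continuousAt.continuousWithinAt) (fun x hx => ?_)
    fun x hx => ?_
  · rw [interior_Ioi] at hx
    exact (h.hasDerivAt_logSlope hm hx).differentiableAt.differentiableWithinAt
  · rw [interior_Ioi] at hx
    rw [(h.hasDerivAt_logSlope hm hx).deriv]
    exact (h.logSlope_deriv_neg hm hx).le

lemma tendsto_logSlope (hm : 2 < m) (h : IsGroundState m Q) :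
    Tendsto (logSlope m Q) atTop (nhds (-1)) := by
  have hanti : Antitone fun r => logSlope m Q (max r 2) := fun a b hab =>
    h.antitoneOn_logSlope hm (mem_Ioi.2 (lt_of_lt_of_le (by norm_num) (le_max_right a 2)))
      (mem_Ioi.2 (lt_of_lt_of_le (by norm_num) (le_max_right b 2))) (max_le_max_right 2 hab)
  have hbdd : BddBelow (range fun r => logSlope m Q (max r 2)) :=
    ⟨-1, by
      rintro _ ⟨r, rfl⟩
      exact h.neg_one_le_logSlope (lt_of_lt_of_le (by norm_num) (le_max_right r 2))⟩
  obtain ⟨l, hl⟩ : ∃ l, Tendsto (logSlope m Q) atTop (nhds l) := by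
    refine ⟨_, (tendsto_atTop_ciInf hanti hbdd).congr' ?_⟩
    filter_upwards [eventually_ge_atTop 2] with r hr
    rw [max_eq_left hr]
  have hl1 : -1 ≤ l := by
    refine ge_of_tendsto hl ?_
    filter_upwards [eventually_gt_atTop 1] with r hr
    exact h.neg_one_le_logSlope hr
  have hl0 : l < 0 := by
    obtain ⟨r, hr, hr1⟩ := (h.eventually_logSlope_neg.and (eventually_gt_atTop 1)).exists
    refine lt_of_le_of_lt (le_of_tendsto hl ?_) hr
    filter_upwards [eventually_ge_atTop r] with x hx
    exact h.antitoneOn_logSlope hm hr1 (mem_Ioi.2 (hr1.trans_le hx)) hx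
  have hlim := (((hl.pow 2).add hl).const_mul ((m : ℝ) + 1)).add (h.tendsto_sq_mul_pow hm)
  have hge : 0 ≤ ((m : ℝ) + 1) * (l ^ 2 + l) + 0 := by
    refine ge_of_tendsto hlim ?_
    filter_upwards [eventually_gt_atTop 1] with r hr
    rw [← h.pohozaev_logSlope hm hr]
    have hm' : (2 : ℝ) < m := by exact_mod_cast hm
    have h1 : 0 < (m : ℝ) - 2 := by linarith
    have h2 := h.massTail_pos hr.le
    positivity
  rw [add_zero] at hge
  have h3 : 0 ≤ l ^ 2 + l := nonneg_of_mul_nonneg_right hge (by positivity)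
  have : l = -1 := le_antisymm (by nlinarith) hl1
  rwa [this] at hl

lemma tendsto_massTail_div (hm : 2 < m) (h : IsGroundState m Q) :
    Tendsto (fun r => tailIntegral (massDensity m Q) r / (r * Q r ^ 2)) atTop (nhds 0) := by
  have hl := h.tendsto_logSlope hm
  have hlim := ((((hl.pow 2).add hl).const_mul ((m : ℝ) + 1)).add
    (h.tendsto_sq_mul_pow hm)).div_const ((m : ℝ) - 2)
  have hm' : (2 : ℝ) < m := by exact_mod_cast hm
  have h1 : (m : ℝ) - 2 ≠ 0 := by linarith
  norm_num at hlim
  refine hlim.congr' ?_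
  filter_upwards [eventually_gt_atTop 1] with r hr
  rw [← h.pohozaev_logSlope hm hr, mul_div_cancel_left₀ _ h1]

/-- The quantity governing the monotonicity of `Q / S` is positive. -/
lemma ratio_deriv_pos (hm : 2 < m) (h : IsGroundState m Q) {r : ℝ} (hr : 1 < r) :
    0 < r ^ 3 * Q r ^ (2 * (m + 1)) + 3 * tailIntegral (massDensity m Q) r +
      2 * ((m : ℝ) + 1) * (tailIntegral (massDensity m Q) r * logSlope m Q r) := by
  set B : ℝ → ℝ := fun r => r ^ 3 * Q r ^ (2 * (m + 1)) + 3 * tailIntegral (massDensity m Q) r +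
      2 * ((m : ℝ) + 1) * (tailIntegral (massDensity m Q) r * logSlope m Q r) with hB
  have hd : ∀ x, 1 < x → HasDerivAt B (2 * ((m : ℝ) + 1) * (tailIntegral (massDensity m Q) x *
      -((((m : ℝ) - 2) * tailIntegral (massDensity m Q) x +
      m * (x ^ 3 * Q x ^ (2 * (m + 1)))) / (((m : ℝ) + 1) * (x * Q x) ^ 2)))) x := fun x hx => by
    have hQ := h.pos x hx
    have hx0 : 0 < x := by linarith
    refine ((((hasDerivAt_pow 3 x).mul ((h.hasDerivAt hx).pow (2 * (m + 1)))).add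
      ((h.hasDerivAt_massTail hx).const_mul 3)).add
      (((h.hasDerivAt_massTail hx).mul (h.hasDerivAt_logSlope hm hx)).const_mul
        (2 * ((m : ℝ) + 1)))).congr_deriv ?_
    simp only [show 2 * (m + 1) - 1 = 2 * m + 1 by omega, Pi.pow_apply, logSlope]
    push_cast
    field_simp
    ring
  have hanti : StrictAntiOn B (Ioi 1) := by
    refine strictAntiOn_of_deriv_neg (convex_Ioi 1)
      (fun x hx => (hd x hx).continuousAt.continuousWithinAt) fun x hx => ?_
    rw [interior_Ioi] at hx
    rw [(hd x hx).deriv]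
    have h1 := h.logSlope_deriv_neg hm hx
    have h2 := h.massTail_pos (le_of_lt hx)
    have h3 := mul_neg_of_pos_of_neg h2 h1
    have : 0 < 2 * ((m : ℝ) + 1) := by positivity
    exact mul_neg_of_pos_of_neg this h3
  have hlim : Tendsto B atTop (nhds 0) := by
    have hZ := tendsto_tailIntegral h.mem.integrable_mass
    have := ((h.tendsto_cube_mul_pow hm).add (hZ.const_mul 3)).add
      ((hZ.mul (h.tendsto_logSlope hm)).const_mul (2 * ((m : ℝ) + 1)))
    simpa using this
  have h1 : 0 ≤ B (r + 1) := by
    refine le_of_tendsto hlim ?_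
    filter_upwards [eventually_ge_atTop (r + 1)] with x hx
    exact hanti.antitoneOn (mem_Ioi.2 (by linarith)) (mem_Ioi.2 (by linarith)) hx
  exact lt_of_le_of_lt h1 (hanti hr (mem_Ioi.2 (by linarith)) (by linarith))

lemma cube_mul_pow_le (hm : 2 < m) (h : IsGroundState m Q) {r : ℝ} (hr : 1 < r) :
    r ^ 3 * Q r ^ (2 * (m + 1)) ≤ (2 * (m : ℝ) - 1) * tailIntegral (massDensity m Q) r := by
  set G : ℝ → ℝ := fun r => r ^ 3 * Q r ^ (2 * (m + 1)) -
    (2 * (m : ℝ) - 1) * tailIntegral (massDensity m Q) r with hG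
  have hd : ∀ x, 1 < x → HasDerivAt G (x ^ 2 * Q x ^ (2 * (m + 1)) * (2 * ((m : ℝ) + 1) *
      (1 + logSlope m Q x))) x := fun x hx => by
    have hQ := h.pos x hx
    have hx0 : 0 < x := by linarith
    refine (((hasDerivAt_pow 3 x).mul ((h.hasDerivAt hx).pow (2 * (m + 1)))).sub
      ((h.hasDerivAt_massTail hx).const_mul (2 * (m : ℝ) - 1))).congr_deriv ?_
    simp only [show 2 * (m + 1) - 1 = 2 * m + 1 by omega, Pi.pow_apply, logSlope]
    push_cast
    field_simp
    ring
  have hmono : MonotoneOn G (Ioi 1) := by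
    refine monotoneOn_of_deriv_nonneg (convex_Ioi 1)
      (fun x hx => (hd x hx).continuousAt.continuousWithinAt) (fun x hx => ?_) fun x hx => ?_
    · rw [interior_Ioi] at hx
      exact (hd x hx).differentiableAt.differentiableWithinAt
    · rw [interior_Ioi] at hx
      rw [(hd x hx).deriv]
      have h1 := h.neg_one_le_logSlope hx
      have h2 := h.pos x hx
      have h3 : 0 ≤ 1 + logSlope m Q x := by linarith
      positivity
  have hlim : Tendsto G atTop (nhds 0) := by
    have := (h.tendsto_cube_mul_pow hm).sub
      ((tendsto_tailIntegral h.mem.integrable_mass).const_mul (2 * (m : ℝ) - 1))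
    simpa using this
  have h1 : G r ≤ 0 := by
    refine ge_of_tendsto hlim ?_
    filter_upwards [eventually_ge_atTop r] with x hx
    exact hmono hr (mem_Ioi.2 (hr.trans_le hx)) hx
  linarith [show G r = _ from rfl]

/-- The scale-invariant parameter `Q / S` along the ground state. -/
noncomputable def ratio (m : ℕ) (Q : ℝ → ℝ) (r : ℝ) : ℝ := Q r / massScale m Q r

/-- The slope `-r Q' / S` along the ground state. -/
noncomputable def slope (m : ℕ) (Q : ℝ → ℝ) (r : ℝ) : ℝ := -flux m Q r / (r * massScale m Q r)

lemma ratio_pow (h : IsGroundState m Q) {r : ℝ} (hr : 1 ≤ r) :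
    ratio m Q r ^ (2 * (m + 1)) * tailIntegral (massDensity m Q) r =
      r ^ 3 * Q r ^ (2 * (m + 1)) := by
  have hZ := h.massTail_pos hr
  have hr0 : 0 < r := by linarith
  rw [ratio, div_pow, massScale_pow hr]
  field_simp

lemma continuousOn_ratio (h : IsGroundState m Q) : ContinuousOn (ratio m Q) (Ici 1) :=
  h.mem.continuousOn.div (continuousOn_massScale h.mem) fun _ hx => (h.scale_pos hx).ne'

lemma continuousOn_slope (h : IsGroundState m Q) : ContinuousOn (slope m Q) (Ici 1) :=
  h.continuousOn_flux.neg.div (continuousOn_id.mul (continuousOn_massScale h.mem)) fun _ hx =>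
    (mul_pos (zero_lt_one.trans_le hx) (h.scale_pos hx)).ne'

lemma hasDerivAt_ratio (h : IsGroundState m Q) {r : ℝ} (hr : 1 < r) :
    HasDerivAt (ratio m Q) ((-slope m Q r + ratio m Q r * (ratio m Q r ^ (2 * (m + 1)) + 3) /
      (2 * ((m : ℝ) + 1))) / r) r := by
  have hS := h.scale_pos hr.le
  have hr0 : 0 < r := by linarith
  refine ((h.hasDerivAt hr).div (hasDerivAt_massScale h.mem hr hS) hS.ne').congr_deriv ?_
  rw [h.abs_eq hr.le]
  change _ = (-slope m Q r + Q r / massScale m Q r *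
    ((Q r / massScale m Q r) ^ (2 * (m + 1)) + 3) / (2 * ((m : ℝ) + 1))) / r
  generalize (Q r / massScale m Q r) ^ (2 * (m + 1)) = P
  unfold slope
  field_simp
  ring

lemma slope_lt (hm : 2 < m) (h : IsGroundState m Q) {r : ℝ} (hr : 1 ≤ r) :
    0 < -slope m Q r + ratio m Q r * (ratio m Q r ^ (2 * (m + 1)) + 3) / (2 * ((m : ℝ) + 1)) := by
  have hS := h.scale_pos hr
  rcases hr.eq_or_lt with rfl | hr1
  · have := h.flux_one_pos
    simp only [slope, ratio, h.mem.apply_one, zero_div, zero_mul, add_zero, neg_div, neg_neg,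
      one_mul]
    positivity
  · have h1 := h.ratio_deriv_pos hm hr1
    have hZ := h.massTail_pos hr
    have hQ := h.pos r hr1
    have hr0 : 0 < r := by linarith
    rw [← h.ratio_pow hr] at h1
    have h2 : -slope m Q r + ratio m Q r * (ratio m Q r ^ (2 * (m + 1)) + 3) / (2 * ((m : ℝ) + 1)) =
      ratio m Q r / (2 * ((m : ℝ) + 1) * tailIntegral (massDensity m Q) r) *
      (ratio m Q r ^ (2 * (m + 1)) * tailIntegral (massDensity m Q) r +
        3 * tailIntegral (massDensity m Q) r +
      2 * ((m : ℝ) + 1) * (tailIntegral (massDensity m Q) r * logSlope m Q r)) := by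
      generalize ratio m Q r ^ (2 * (m + 1)) = P
      unfold slope ratio logSlope
      field_simp
      ring
    rw [h2]
    have : 0 < ratio m Q r := div_pos hQ hS
    positivity

lemma strictMonoOn_ratio (hm : 2 < m) (h : IsGroundState m Q) :
    StrictMonoOn (ratio m Q) (Ici 1) := by
  refine strictMonoOn_of_deriv_pos (convex_Ici 1) h.continuousOn_ratio fun x hx => ?_
  rw [interior_Ici] at hx
  have hx1 : 1 < x := hx
  rw [(h.hasDerivAt_ratio hx1).deriv]
  exact div_pos (h.slope_lt hm hx1.le) (by linarith)

lemma ratio_le (hm : 2 < m) (h : IsGroundState m Q) {r : ℝ} (hr : 1 < r) :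
    ratio m Q r ≤ 2 * (m : ℝ) - 1 := by
  have hm' : (2 : ℝ) < m := by exact_mod_cast hm
  have hZ := h.massTail_pos hr.le
  have h1 := h.cube_mul_pow_le hm hr
  rw [← h.ratio_pow hr.le] at h1
  have h2 := le_of_mul_le_mul_right h1 hZ
  refine le_of_pow_le_pow_left₀ (n := 2 * (m + 1)) (by omega) (by linarith) (h2.trans ?_)
  exact le_self_pow₀ (by linarith) (by omega)

lemma exists_tendsto_ratio (hm : 2 < m) (h : IsGroundState m Q) :
    ∃ l, Tendsto (ratio m Q) atTop (nhds l) := by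
  have hmono : Monotone fun r => ratio m Q (max r 2) := fun a b hab =>
    (h.strictMonoOn_ratio hm).monotoneOn
      (mem_Ici.2 (le_trans (by norm_num) (le_max_right a 2)))
      (mem_Ici.2 (le_trans (by norm_num) (le_max_right b 2))) (max_le_max_right 2 hab)
  have hbdd : BddAbove (range fun r => ratio m Q (max r 2)) :=
    ⟨2 * (m : ℝ) - 1, by
      rintro _ ⟨r, rfl⟩
      exact h.ratio_le hm (lt_of_lt_of_le (by norm_num) (le_max_right r 2))⟩
  refine ⟨_, (tendsto_atTop_ciSup hmono hbdd).congr' ?_⟩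
  filter_upwards [eventually_ge_atTop 2] with r hr
  rw [max_eq_left hr]

/-- The normalised energy `E / (r S²)` along the ground state. -/
noncomputable def profile (m : ℕ) (Q : ℝ → ℝ) (r : ℝ) : ℝ :=
  tailIntegral (energyDensity Q) r / (r * massScale m Q r ^ 2)

lemma continuousOn_profile (h : IsGroundState m Q) : ContinuousOn (profile m Q) (Ici 1) :=
  (continuousOn_tailIntegral h.mem.integrable_energy).div
    (continuousOn_id.mul ((continuousOn_massScale h.mem).pow 2)) fun _ hx =>
    (mul_pos (zero_lt_one.trans_le hx) (pow_pos (h.scale_pos hx) 2)).ne'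

lemma profile_hamilton_jacobi (hm : 2 < m) (h : IsGroundState m Q) {r : ℝ} (hr : 1 ≤ r) :
    ((m : ℝ) + 1) * (profile m Q r - slope m Q r ^ 2) =
      (ratio m Q r ^ (2 * (m + 1)) + 3) * (profile m Q r - ratio m Q r * slope m Q r) := by
  have hS := h.scale_pos hr
  have hr0 : 0 < r := by linarith
  have h1 := h.pohozaev hm hr
  have h2 := h.ratio_pow hr
  rw [← h2] at h1
  unfold profile
  rw [h.energy_identity hr]
  generalize ratio m Q r ^ (2 * (m + 1)) = P at *
  unfold slope ratio
  field_simp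
  have hr0' := hr0.ne'
  field_simp at h1
  linear_combination h1

lemma hasDerivAt_profile (hm : 2 < m) (h : IsGroundState m Q) {r : ℝ} (hr : 1 < r) :
    HasDerivAt (profile m Q) (2 * slope m Q r * ((-slope m Q r + ratio m Q r *
      (ratio m Q r ^ (2 * (m + 1)) + 3) / (2 * ((m : ℝ) + 1))) / r)) r := by
  have hS := h.scale_pos hr.le
  have hr0 : 0 < r := by linarith
  have hHJ := h.profile_hamilton_jacobi hm hr.le
  refine ((h.hasDerivAt_energyTail hr).div ((hasDerivAt_id r).mul
    ((hasDerivAt_massScale h.mem hr hS).pow 2))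
    (by simp only [id, Pi.mul_apply, Pi.pow_apply]; positivity)).congr_deriv ?_
  rw [h.abs_eq hr.le]
  change (_ - _ * (_ + _ * (_ * _ * -(_ * (ratio m Q r ^ (2 * (m + 1)) + 3)))))  / _ = _
  simp only [id, Pi.mul_apply, Pi.pow_apply]
  generalize ratio m Q r ^ (2 * (m + 1)) = P at *
  unfold slope ratio profile at *
  field_simp at hHJ ⊢
  linear_combination (-2 * massScale m Q r) * hHJ

lemma tendsto_slope (hm : 2 < m) (h : IsGroundState m Q) {l : ℝ}
    (hl : Tendsto (ratio m Q) atTop (nhds l)) : Tendsto (slope m Q) atTop (nhds l) := by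
  have h1 := (h.tendsto_logSlope hm).neg.mul hl
  rw [neg_neg, one_mul] at h1
  refine h1.congr' ?_
  filter_upwards [eventually_gt_atTop 1] with r hr
  have hS := h.scale_pos hr.le
  have hQ := h.pos r hr
  have hr0 : 0 < r := by linarith
  unfold logSlope ratio slope
  field_simp

lemma tendsto_profile (hm : 2 < m) (h : IsGroundState m Q) {l : ℝ}
    (hl : Tendsto (ratio m Q) atTop (nhds l)) : Tendsto (profile m Q) atTop (nhds (l ^ 2)) := by
  have h1 := (hl.pow 2).mul ((h.tendsto_massTail_div hm).sub (h.tendsto_logSlope hm))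
  rw [show l ^ 2 * (0 - -1) = l ^ 2 by ring] at h1
  refine h1.congr' ?_
  filter_upwards [eventually_gt_atTop 1] with r hr
  have hS := h.scale_pos hr.le
  have hQ := h.pos r hr
  have hr0 : 0 < r := by linarith
  unfold profile
  rw [h.energy_identity hr.le]
  unfold logSlope ratio
  field_simp

end IsGroundState

/-! ### Uniqueness for the autonomous field -/

/-- Two absolutely continuous solutions of `r u' = Ψ(u)` with positive `Ψ` and the same initial
value coincide. -/
lemma eq_of_ae_field {Ψ u v u' v' : ℝ → ℝ} {a b M : ℝ} (hΨ : Continuous Ψ)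
    (hpos : ∀ ξ ∈ Icc 0 M, 0 < Ψ ξ) (ha : 0 < a) (hab : a ≤ b) (hM : 0 ≤ M)
    (huc : ContinuousOn u (Icc a b)) (hvc : ContinuousOn v (Icc a b))
    (hum : ∀ r ∈ Icc a b, u r ∈ Icc 0 M) (hvm : ∀ r ∈ Icc a b, v r ∈ Icc 0 M)
    (hud : ∀ r ∈ Ioo a b, HasDerivWithinAt u (u' r) (Ioi r) r)
    (hvd : ∀ r ∈ Ioo a b, HasDerivWithinAt v (v' r) (Ioi r) r)
    (hue : ∀ᵐ r ∂(volume.restrict (Ioc a b)), u' r = Ψ (u r) / r)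
    (hve : ∀ᵐ r ∂(volume.restrict (Ioc a b)), v' r = Ψ (v r) / r)
    (heq : u a = v a) : u b = v b := by
  set k : ℝ → ℝ := fun ξ => (Ψ (max 0 (min ξ M)))⁻¹ with hk
  have hkpos : ∀ ξ, 0 < Ψ (max 0 (min ξ M)) := fun ξ =>
    hpos _ ⟨le_max_left _ _, max_le hM (min_le_right _ _)⟩
  have hkc : Continuous k :=
    (hΨ.comp (continuous_const.max (continuous_id.min continuous_const))).inv₀
      fun ξ => (hkpos ξ).ne'
  have hkeq : ∀ ξ ∈ Icc 0 M, k ξ = (Ψ ξ)⁻¹ := fun ξ hξ => by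
    simp only [hk]; rw [min_eq_left hξ.2, max_eq_right hξ.1]
  set Θ : ℝ → ℝ := fun x => ∫ ξ in (0 : ℝ)..x, k ξ with hΘ
  have hΘd : ∀ x, HasDerivAt Θ (k x) x := fun x => hkc.integral_hasStrictDerivAt 0 x |>.hasDerivAt
  have hΘm : StrictMono Θ := strictMono_of_hasDerivAt_pos hΘd fun x => inv_pos.2 (hkpos x)
  have key : ∀ w w' : ℝ → ℝ, ContinuousOn w (Icc a b) → (∀ r ∈ Icc a b, w r ∈ Icc 0 M) →
      (∀ r ∈ Ioo a b, HasDerivWithinAt w (w' r) (Ioi r) r) →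
      (∀ᵐ r ∂(volume.restrict (Ioc a b)), w' r = Ψ (w r) / r) →
      Θ (w b) - Θ (w a) = ∫ r in a..b, r⁻¹ := by
    intro w w' hwc hwm hwd hwe
    have hint : IntervalIntegrable (fun r : ℝ => r⁻¹) volume a b := by
      refine intervalIntegral.intervalIntegrable_inv (fun x hx => ?_) continuousOn_id
      rw [uIcc_of_le hab] at hx
      exact (ha.trans_le hx.1).ne'
    have hae : ∀ᵐ r ∂(volume.restrict (uIoc a b)), r⁻¹ = k (w r) * w' r := by
      rw [uIoc_of_le hab]
      filter_upwards [hwe, ae_restrict_mem measurableSet_Ioc] with r hr hrm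
      have hm := hwm r ⟨hrm.1.le, hrm.2⟩
      have := (hpos _ hm).ne'
      rw [hr, hkeq _ hm]
      field_simp
    rw [← intervalIntegral.integral_eq_sub_of_hasDeriv_right (f := fun r => Θ (w r))
      (f' := fun r => k (w r) * w' r) (a := a) (b := b) ?_ ?_ (hint.congr_ae hae)]
    · exact (intervalIntegral.integral_congr_ae_restrict hae).symm
    · rw [uIcc_of_le hab]
      exact (continuous_iff_continuousAt.2 fun x => (hΘd x).continuousAt).comp_continuousOn hwc
    · intro r hr
      rw [min_eq_left hab, max_eq_right hab] at hr
      exact (hΘd (w r)).comp_hasDerivWithinAt r (hwd r hr)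
  have h1 := key u u' huc hum hud hue
  have h2 := key v v' hvc hvm hvd hve
  rw [heq] at h1
  exact hΘm.injective (by linarith)

namespace IsGroundState

variable {m : ℕ} {Q f : ℝ → ℝ}

/-! ### The calibration defined by the ground state -/

lemma exists_calibration (hm : 2 < m) (h : IsGroundState m Q) :
    ∃ χ η : ℝ → ℝ, ∃ l : ℝ, Calibration m χ η ∧ χ 0 = profile m Q 1 ∧
      (∀ r, 1 ≤ r → η (ratio m Q r) = slope m Q r) ∧ (∀ r, 1 ≤ r → ratio m Q r < l) ∧
      ∀ x, 0 ≤ x → x < l → 0 < -η x + x * (x ^ (2 * (m + 1)) + 3) / (2 * ((m : ℝ) + 1)) := by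
  obtain ⟨l, hl⟩ := h.exists_tendsto_ratio hm
  have hX1 : ratio m Q 1 = 0 := by simp [ratio, h.mem.apply_one]
  obtain ⟨η, hηc, hηr, hηl, hlt, hsurj⟩ := exists_continuous_factor h.continuousOn_ratio
    (h.strictMonoOn_ratio hm) hX1 hl h.continuousOn_slope (h.tendsto_slope hm hl)
  have hl0 : 0 < l := hX1 ▸ hlt 1 le_rfl
  set χ : ℝ → ℝ := fun x => profile m Q 1 + ∫ ξ in (0 : ℝ)..x, 2 * η ξ with hχ
  have hχd : ∀ x, HasDerivAt χ (2 * η x) x := fun x =>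
    (((continuous_const.mul hηc).integral_hasStrictDerivAt 0 x).hasDerivAt).const_add _
  have hχc : Continuous χ := continuous_iff_continuousAt.2 fun x => (hχd x).continuousAt
  have hχ0 : χ 0 = profile m Q 1 := by simp [hχ]
  have hχr : ∀ r, 1 ≤ r → χ (ratio m Q r) = profile m Q r := fun r hr => by
    have := eq_of_hasDerivAt_zero (F := fun r => χ (ratio m Q r) - profile m Q r)
      ((hχc.comp_continuousOn h.continuousOn_ratio).sub h.continuousOn_profile)
      (fun x hx => by
        refine (((hχd _).comp x (h.hasDerivAt_ratio hx)).sub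
          (h.hasDerivAt_profile hm hx)).congr_deriv ?_
        rw [hηr x hx.le, sub_self]) hr
    simp only [hX1, hχ0, sub_self] at this
    linarith
  have hχl : χ l = l ^ 2 := by
    refine tendsto_nhds_unique (((hχc.tendsto l).comp hl).congr' ?_) (h.tendsto_profile hm hl)
    filter_upwards [eventually_ge_atTop 1] with r hr
    exact hχr r hr
  have hχsq : ∀ x, l ≤ x → χ x = x ^ 2 := fun x hx => by
    have h1 : χ x - χ l = ∫ ξ in l..x, 2 * η ξ :=
      (intervalIntegral.integral_eq_sub_of_hasDerivAt (fun y _ => hχd y)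
        ((continuous_const.mul hηc).intervalIntegrable _ _)).symm
    have h2 : ∫ ξ in l..x, 2 * η ξ = ∫ ξ in l..x, 2 * ξ :=
      intervalIntegral.integral_congr fun y hy => by
        rw [uIcc_of_le hx] at hy
        simp only [hηl y hy.1]
    rw [h2, intervalIntegral.integral_const_mul, integral_id, hχl] at h1
    linarith
  refine ⟨χ, η, l, ⟨hηc, hχd, fun x hx => ?_, fun x hx => ?_, ?_⟩, hχ0, hηr, hlt,
    fun x hx hxl => ?_⟩
  · rcases lt_or_ge x l with hxl | hxl
    · obtain ⟨r, hr, rfl⟩ := hsurj x hx hxl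
      rw [hχr r hr, hηr r hr]
      exact h.profile_hamilton_jacobi hm hr
    · rw [hχsq x hxl, hηl x hxl]
      ring
  · rcases lt_or_ge x l with hxl | hxl
    · obtain ⟨r, hr, rfl⟩ := hsurj x hx hxl
      rw [hχr r hr]
      have h1 := tailIntegral_nonneg (energyDensity_nonneg Q) r
      have h2 := h.scale_pos hr
      unfold profile
      positivity
    · rw [hχsq x hxl]
      positivity
  · obtain ⟨C, hC⟩ := (isCompact_Icc (a := (0 : ℝ)) (b := l)).bddAbove_image hχc.continuousOn
    refine ⟨max C 1, by positivity, fun x hx => ?_⟩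
    rcases lt_or_ge x l with hxl | hxl
    · have h1 : χ x ≤ C := hC ⟨x, ⟨hx, hxl.le⟩, rfl⟩
      have h2 : (0 : ℝ) ≤ max C 1 := by positivity
      nlinarith [le_max_left C 1, mul_nonneg h2 (sq_nonneg x)]
    · rw [hχsq x hxl]
      nlinarith [le_max_right C 1, sq_nonneg x]
  · obtain ⟨r, hr, rfl⟩ := hsurj x hx hxl
    rw [hηr r hr]
    exact h.slope_lt hm hr

lemma value_one {χ : ℝ → ℝ} (h : IsGroundState m Q) (hf : RadialH10 m f)
    (hχ : χ 0 = profile m Q 1) : massScale m Q 1 ^ 2 * calibrationValue m χ f 1 =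
      massScale m f 1 ^ 2 * tailIntegral (energyDensity Q) 1 := by
  have := (h.scale_pos le_rfl).ne'
  simp only [calibrationValue, hf.apply_one, abs_zero, zero_div, hχ, profile, one_mul]
  field_simp

/-- The sharp Sobolev inequality in scale-invariant form. -/
lemma sobolev (hm : 2 < m) (h : IsGroundState m Q) (hf : RadialH10 m f) :
    massScale m f 1 ^ 2 * tailIntegral (energyDensity Q) 1 ≤
      massScale m Q 1 ^ 2 * tailIntegral (energyDensity f) 1 := by
  obtain ⟨χ, η, l, hc, hχ, -⟩ := h.exists_calibration hm
  rw [← h.value_one hf hχ]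
  exact mul_le_mul_of_nonneg_left (hc.value_le hm hf le_rfl) (sq_nonneg _)

/-! ### The equality case -/

lemma abs_eq_of_sobolev_eq (hm : 2 < m) (h : IsGroundState m Q) (hf : RadialH10 m f)
    (heq : massScale m f 1 ^ 2 * tailIntegral (energyDensity Q) 1 =
      massScale m Q 1 ^ 2 * tailIntegral (energyDensity f) 1) (hS1 : 0 < massScale m f 1) {R : ℝ}
    (hR : 1 ≤ R) : |f R| = massScale m f 1 / massScale m Q 1 * Q R := by
  obtain ⟨χ, η, l, hc, hχ, hηr, hlt, hΨ⟩ := h.exists_calibration hm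
  have hSQ1 := h.scale_pos le_rfl
  rw [← h.value_one hf hχ] at heq
  have hval := mul_left_cancel₀ (pow_pos hSQ1 2).ne' heq
  set c := massScale m f 1 / massScale m Q 1 with hcdef
  have hc0 : 0 < c := div_pos hS1 hSQ1
  have hSc := continuousOn_massScale hf
  have hSQc := continuousOn_massScale h.mem
  set g : ℝ → ℝ × ℝ := fun r => (massScale m f r - c * massScale m Q r, |f r| - c * Q r) with hg
  have hgc : ContinuousOn g (Ici 1) :=
    (hSc.sub (hSQc.const_mul c)).prodMk (hf.continuousOn.abs.sub (h.mem.continuousOn.const_mul c))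
  have hmem : ∀ r, r ∈ g ⁻¹' {0} ↔ massScale m f r = c * massScale m Q r ∧ |f r| = c * Q r :=
    fun r => by simp [hg, Prod.ext_iff, sub_eq_zero]
  have hclosed : IsClosed (g ⁻¹' {0} ∩ Icc 1 R) := by
    rw [inter_comm]
    exact (hgc.mono Icc_subset_Ici_self).preimage_isClosed_of_isClosed isClosed_Icc
      isClosed_singleton
  have hsub : Icc 1 R ⊆ g ⁻¹' {0} := by
    refine hclosed.Icc_subset_of_forall_exists_gt ?_ ?_
    · rw [hmem]
      refine ⟨by rw [hcdef]; field_simp, by simp [hf.apply_one, h.mem.apply_one]⟩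
    rintro a ⟨haJ, ha1, -⟩ y hy
    obtain ⟨haS, haf⟩ := (hmem a).1 haJ
    have hSa : 0 < massScale m f a := by rw [haS]; exact mul_pos hc0 (h.scale_pos ha1)
    have hxa : |f a| / massScale m f a = ratio m Q a := by
      rw [haS, haf, ratio, mul_div_mul_left _ _ hc0.ne']
    set M := (ratio m Q a + l) / 2 with hMdef
    have haM : ratio m Q a < M := by linarith [hlt a ha1]
    have hMl : M < l := by linarith [hlt a ha1]
    have hsubI : Ici a ⊆ Ici 1 := Ici_subset_Ici.2 ha1
    have hSca : ContinuousWithinAt (massScale m f) (Ici a) a := (hSc a ha1).mono hsubI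
    have hxca : ContinuousWithinAt (fun r => |f r| / massScale m f r) (Ici a) a :=
      ((hf.continuousOn.abs a ha1).mono hsubI).div hSca hSa.ne'
    have hev : ∀ᶠ r in nhdsWithin a (Ici a), 0 < massScale m f r ∧
        |f r| / massScale m f r < M ∧ ratio m Q r < M :=
      (hSca.eventually (lt_mem_nhds hSa)).and
        ((hxca.eventually (gt_mem_nhds (hxa.trans_lt haM))).and
          (((h.continuousOn_ratio a ha1).mono hsubI).eventually (gt_mem_nhds haM)))
    obtain ⟨u, hau, hu⟩ := mem_nhdsGE_iff_exists_Icc_subset.1 hev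
    set b := min u y with hb
    have hab : a < b := lt_min hau hy
    have hI : ∀ r ∈ Icc a b, 0 < massScale m f r ∧ |f r| / massScale m f r < M ∧
        ratio m Q r < M := fun r hr => hu ⟨hr.1, hr.2.trans (min_le_left _ _)⟩
    have hI1 : Icc a b ⊆ Ici 1 := fun r hr => ha1.trans hr.1
    have hratio0 : ∀ r, 1 ≤ r → 0 ≤ ratio m Q r := fun r hr =>
      div_nonneg (h.nonneg hr) (h.scale_pos hr).le
    have hx : ∀ r ∈ Icc a b, |f r| / massScale m f r = ratio m Q r := by
      intro r hr
      have hsub' : Icc a r ⊆ Icc a b := Icc_subset_Icc_right hr.2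
      refine eq_of_ae_field (M := M)
        (Ψ := fun x => -η x + x * (x ^ (2 * (m + 1)) + 3) / (2 * ((m : ℝ) + 1)))
        (u := fun r => |f r| / massScale m f r) (v := ratio m Q)
        (by have := hc.continuous_slope; fun_prop) (fun ξ hξ => hΨ ξ hξ.1 (hξ.2.trans_lt hMl))
        (by linarith) hr.1 ((hratio0 a ha1).trans haM.le)
        ((hf.continuousOn.abs.mono (hsub'.trans hI1)).div (hSc.mono (hsub'.trans hI1))
          fun x hx => (hI x (hsub' hx)).1.ne')
        (h.continuousOn_ratio.mono (hsub'.trans hI1))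
        (fun x hx => ⟨div_nonneg (abs_nonneg _) (hI x (hsub' hx)).1.le, (hI x (hsub' hx)).2.1.le⟩)
        (fun x hx => ⟨hratio0 x (hI1 (hsub' hx)), (hI x (hsub' hx)).2.2.le⟩)
        (fun x hx => hasDerivWithinAt_ratio hf (ha1.trans_lt hx.1)
          (hI x (hsub' ⟨hx.1.le, hx.2.le⟩)).1)
        (fun x hx => (h.hasDerivAt_ratio (ha1.trans_lt hx.1)).hasDerivWithinAt) ?_ ?_ hxa
      · filter_upwards [hc.ae_eq_field hm hf hval ha1 hr.1 fun x hx => (hI x (hsub' hx)).1,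
          ae_restrict_mem measurableSet_Ioc] with x hx hxm
        have hS := (hI x (hsub' ⟨hxm.1.le, hxm.2⟩)).1
        have hx0 : 0 < x := by linarith [hxm.1]
        generalize η (|f x| / massScale m f x) = e at *
        generalize (|f x| / massScale m f x) ^ (2 * (m + 1)) = P at *
        have : absRightDeriv f x = -(massScale m f x * e) / x := by
          rw [eq_div_iff hx0.ne']; linarith
        rw [this]
        field_simp
      · filter_upwards [ae_restrict_mem measurableSet_Ioc] with x hx
        rw [hηr x (ha1.trans hx.1.le)]
    have hq : massScale m f b / massScale m Q b = massScale m f a / massScale m Q a := by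
      have := intervalIntegral.integral_eq_sub_of_hasDeriv_right (a := a) (b := b)
        (f := fun r => massScale m f r / massScale m Q r) (f' := fun _ => 0)
        (by
          rw [uIcc_of_le hab.le]
          exact (hSc.mono hI1).div (hSQc.mono hI1) fun x hx => (h.scale_pos (hI1 hx)).ne')
        (fun r hr => by
          rw [min_eq_left hab.le, max_eq_right hab.le] at hr
          have hr1 : 1 < r := ha1.trans_lt hr.1
          have hS := (hI r ⟨hr.1.le, hr.2.le⟩).1
          have hSQ := h.scale_pos hr1.le
          refine ((hasDerivAt_massScale hf hr1 hS).div (hasDerivAt_massScale h.mem hr1 hSQ)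
            hSQ.ne').hasDerivWithinAt.congr_deriv ?_
          rw [hx r ⟨hr.1.le, hr.2.le⟩, h.abs_eq hr1.le, ← ratio]
          ring) (by simp)
      simp only [intervalIntegral.integral_zero] at this
      linarith
    refine ⟨b, ?_, hab, min_le_right _ _⟩
    have hbI : b ∈ Icc a b := ⟨hab.le, le_rfl⟩
    have hSQb := h.scale_pos (hI1 hbI)
    rw [hmem]
    rw [haS, mul_div_cancel_right₀ _ (h.scale_pos ha1).ne', div_eq_iff hSQb.ne'] at hq
    refine ⟨hq, ?_⟩
    have h1 := hx b hbI
    rw [div_eq_iff (hI b hbI).1.ne', hq, ratio] at h1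
    rw [h1]
    field_simp
  exact ((hmem R).1 (hsub ⟨hR, le_rfl⟩)).2

lemma exists_eq_mul_of_abs_eq (h : IsGroundState m Q) (hf : RadialH10 m f) {c : ℝ} (hc : 0 < c)
    (habs : ∀ r, 1 ≤ r → |f r| = c * Q r) : ∃ σ : ℝ, ∀ r : ℝ, 1 ≤ r → f r = σ * Q r := by
  have hcont : ContinuousOn f (Ioi 1) := hf.continuousOn.mono Ioi_subset_Ici_self
  have hne : ∀ r ∈ Ioi (1 : ℝ), f r ≠ 0 := fun r hr h0 => by
    have := habs r (le_of_lt hr)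
    rw [h0, abs_zero] at this
    exact (mul_pos hc (h.pos r hr)).ne this
  have hsign : (∀ r, 1 < r → 0 < f r) ∨ ∀ r, 1 < r → f r < 0 := by
    by_contra! hcon
    obtain ⟨⟨a, ha, ha0⟩, b, hb, hb0⟩ := hcon
    obtain ⟨r, hr, hr0⟩ := isPreconnected_Ioi.intermediate_value (mem_Ioi.2 ha) (mem_Ioi.2 hb) hcont
      ⟨ha0, hb0⟩
    exact hne r hr hr0
  rcases hsign with hs | hs
  · refine ⟨c, fun r hr => ?_⟩
    rcases hr.eq_or_lt with rfl | hr1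
    · rw [hf.apply_one, h.mem.apply_one, mul_zero]
    · rw [← habs r hr, abs_of_pos (hs r hr1)]
  · refine ⟨-c, fun r hr => ?_⟩
    rcases hr.eq_or_lt with rfl | hr1
    · rw [hf.apply_one, h.mem.apply_one, mul_zero]
    · rw [neg_mul, ← habs r hr, abs_of_neg (hs r hr1), neg_neg]

lemma sobolev_eq_of_eq_mul {σ : ℝ} (hσ : ∀ r : ℝ, 1 ≤ r → f r = σ * Q r) :
    massScale m f 1 ^ 2 * tailIntegral (energyDensity Q) 1 =
      massScale m Q 1 ^ 2 * tailIntegral (energyDensity f) 1 := by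
  have hZ : tailIntegral (massDensity m f) 1 = |σ| ^ (2 * (m + 1)) *
      tailIntegral (massDensity m Q) 1 := by
    unfold tailIntegral
    rw [← integral_const_mul]
    refine setIntegral_congr_fun measurableSet_Ioi fun r hr => ?_
    simp only [massDensity]
    rw [hσ r (le_of_lt hr), abs_mul, mul_pow, mul_assoc]
  have hE : tailIntegral (energyDensity f) 1 = σ ^ 2 * tailIntegral (energyDensity Q) 1 := by
    unfold tailIntegral
    rw [← integral_const_mul]
    refine setIntegral_congr_fun measurableSet_Ioi fun r hr => ?_
    have : deriv f r = σ * deriv Q r := by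
      rw [← deriv_const_mul_field]
      refine Filter.EventuallyEq.deriv_eq ?_
      filter_upwards [Ioi_mem_nhds hr] with x hx
      exact hσ x (le_of_lt hx)
    simp only [energyDensity]
    rw [this]
    ring
  have hS : massScale m f 1 = |σ| * massScale m Q 1 := by
    refine (pow_left_inj₀ (massScale_nonneg le_rfl)
      (mul_nonneg (abs_nonneg σ) (massScale_nonneg le_rfl))
      (show 2 * (m + 1) ≠ 0 by omega)).1 ?_
    rw [mul_pow, massScale_pow le_rfl, massScale_pow le_rfl, hZ, mul_div_assoc]
  rw [hS, hE, mul_pow, sq_abs]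
  ring

lemma sobolev_eq_iff (hm : 2 < m) (h : IsGroundState m Q) (hf : RadialH10 m f) :
    massScale m f 1 ^ 2 * tailIntegral (energyDensity Q) 1 =
      massScale m Q 1 ^ 2 * tailIntegral (energyDensity f) 1 ↔
    ∃ σ : ℝ, ∀ r : ℝ, 1 ≤ r → f r = σ * Q r := by
  refine ⟨fun heq => ?_, fun ⟨σ, hσ⟩ => sobolev_eq_of_eq_mul hσ⟩
  by_cases hS1 : 0 < massScale m f 1
  · exact h.exists_eq_mul_of_abs_eq hf (div_pos hS1 (h.scale_pos le_rfl))
      fun r hr => h.abs_eq_of_sobolev_eq hm hf heq hS1 hr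
  · refine ⟨0, fun r hr => ?_⟩
    rw [zero_mul]
    exact (hf.eq_zero_of_massTail le_rfl (Calibration.massTail_eq_zero le_rfl hS1) hr).2

end IsGroundState

/-! ### Norms -/

lemma lpNorm_eq (m : ℕ) (f : ℝ → ℝ) :
    lpNorm m f = (4 * π) ^ ((1 : ℝ) / (2 * ((m : ℝ) + 1))) * massScale m f 1 := by
  rw [massScale, one_pow, div_one, ← Real.mul_rpow (by positivity) (massTail_nonneg m f 1)]
  rfl

lemma gradNorm_eq (f : ℝ → ℝ) :
    gradNorm f = √(4 * π) * √(tailIntegral (energyDensity f) 1) := by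
  rw [← Real.sqrt_mul (by positivity)]
  rfl

/-- Sharp Sobolev inequality with the ground state `Q₀` as extremizer:
`‖f‖_{L^{2(m+1)}} ‖∇Q₀‖_{L²} ≤ ‖Q₀‖_{L^{2(m+1)}} ‖∇f‖_{L²}` for every radial
`f ∈ Ḣ¹₀(Ω)`, with equality iff `f` is a multiple of `Q₀`. -/
theorem sharp_sobolev_ground_state
    (m : ℕ) (hm : 2 < m) (Q0 : ℝ → ℝ)
    (hQ0mem : RadialH10 m Q0)
    (hQ0reg : ContDiffOn ℝ 2 Q0 (Ioi 1))
    (hQ0eq : ∀ r : ℝ, 1 < r →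
      deriv (deriv Q0) r + (2 / r) * deriv Q0 r + |Q0 r| ^ (2 * m) * Q0 r = 0)
    (hQ0pos : ∀ r : ℝ, 1 < r → 0 < Q0 r) :
    ∀ f : ℝ → ℝ, RadialH10 m f →
      lpNorm m f * gradNorm Q0 ≤ lpNorm m Q0 * gradNorm f ∧
      (lpNorm m f * gradNorm Q0 = lpNorm m Q0 * gradNorm f ↔
        ∃ σ : ℝ, ∀ r : ℝ, 1 ≤ r → f r = σ * Q0 r) := by
  intro f hf
  have h : IsGroundState m Q0 := ⟨hQ0mem, hQ0reg, hQ0eq, hQ0pos⟩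
  have hK : 0 < (4 * π) ^ ((1 : ℝ) / (2 * ((m : ℝ) + 1))) * √(4 * π) := by positivity
  have hSf := massScale_nonneg (m := m) (f := f) le_rfl
  have hSQ := massScale_nonneg (m := m) (f := Q0) le_rfl
  have hEf := tailIntegral_nonneg (energyDensity_nonneg f) 1
  have hEQ := tailIntegral_nonneg (energyDensity_nonneg Q0) 1
  have hL : lpNorm m f * gradNorm Q0 = (4 * π) ^ ((1 : ℝ) / (2 * ((m : ℝ) + 1))) * √(4 * π) *
      (massScale m f 1 * √(tailIntegral (energyDensity Q0) 1)) := by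
    rw [lpNorm_eq, gradNorm_eq]; ring
  have hR : lpNorm m Q0 * gradNorm f = (4 * π) ^ ((1 : ℝ) / (2 * ((m : ℝ) + 1))) * √(4 * π) *
      (massScale m Q0 1 * √(tailIntegral (energyDensity f) 1)) := by
    rw [lpNorm_eq, gradNorm_eq]; ring
  rw [hL, hR, mul_le_mul_iff_right₀ hK, mul_right_inj' hK.ne', ← h.sobolev_eq_iff hm hf,
    ← pow_le_pow_iff_left₀ (by positivity) (by positivity) two_ne_zero,
    ← pow_left_inj₀ (n := 2) (a := massScale m f 1 * _) (by positivity) (by positivity)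
      two_ne_zero, mul_pow, mul_pow, Real.sq_sqrt hEf, Real.sq_sqrt hEQ]
  exact ⟨h.sobolev hm hf, Iff.rfl⟩
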